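/- arXiv:2410.16765 — 10 statements merged into one kernel-verified Lean document; each statement's English description precedes it below -/
import Mathlib

section
/- (IPCW identity for the event term Ψ) Fix a time horizon ζ ∈ ℝ with G(ζ) > 0. Then for every event index k ∈ Fin K, the inverse-probability-of-censoring-weighted observed event indicator integrates to the latent cumulative incidence: ∫_Ω 1{T(ω) ≤ ζ ∧ Δ(ω) = k ∧ T(ω) < C(ω)} / G(T(ω)) dℙ(ω) = F_k(ζ) = ℙ(T ≤ ζ ∧ Δ = k). -/
open MeasureTheory ProbabilityTheory

/-- (IPCW identity for the event term Ψ) For a horizon `ζ` with `G ζ > 0`, the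
IPCW-reweighted observed event indicator integrates to the latent cumulative
incidence `F k ζ = P(T ≤ ζ ∧ Δ = k)`. -/
theorem ipcw_event_term
    {Ω : Type*} [MeasurableSpace Ω] (P : Measure Ω) [IsProbabilityMeasure P]
    {K : ℕ} (hK : 1 ≤ K)
    (T : Ω → ℝ) (Δ : Ω → Fin K) (C : Ω → ℝ)
    (hT : Measurable T) (hΔ : Measurable Δ) (hC : Measurable C)
    (hindep : IndepFun (fun ω => (T ω, Δ ω)) C P)
    (G : ℝ → ℝ) (hG : ∀ t, G t = (P {ω | t < C ω}).toReal)
    (F : Fin K → ℝ → ℝ)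
    (hF : ∀ k ζ, F k ζ = (P {ω | T ω ≤ ζ ∧ Δ ω = k}).toReal)
    (ζ : ℝ) (hGζ : 0 < G ζ) (k : Fin K) :
    ∫ ω, Set.indicator {ω' | T ω' ≤ ζ ∧ Δ ω' = k ∧ T ω' < C ω'}
        (fun ω' => 1 / G (T ω')) ω ∂P = F k ζ := by
  have hanti : Antitone G := by
    intro a b hab
    rw [hG, hG]
    exact ENNReal.toReal_mono (measure_ne_top _ _)
      (measure_mono (fun ω (h : b < C ω) => lt_of_le_of_lt hab h))
  have hGm : Measurable G := hanti.measurable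
  have hX : Measurable (fun ω => (T ω, Δ ω)) := hT.prodMk hΔ
  have hmap := (indepFun_iff_map_prod_eq_prod_map_map hX.aemeasurable hC.aemeasurable).1 hindep
  haveI : IsProbabilityMeasure (P.map C) := Measure.isProbabilityMeasure_map hC.aemeasurable
  haveI : IsProbabilityMeasure (P.map (fun ω => (T ω, Δ ω))) :=
    Measure.isProbabilityMeasure_map hX.aemeasurable
  set S : Set ((ℝ × Fin K) × ℝ) := {p | p.1.1 ≤ ζ ∧ p.1.2 = k ∧ p.1.1 < p.2} with hS
  set A : Set (ℝ × Fin K) := {p | p.1 ≤ ζ ∧ p.2 = k} with hA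
  have hAm : MeasurableSet A :=
    (measurableSet_le measurable_fst measurable_const).inter
      (measurable_snd (measurableSet_singleton k))
  have hSm : MeasurableSet S := by
    have h1 : MeasurableSet {p : (ℝ × Fin K) × ℝ | p.1.1 < p.2} :=
      measurableSet_lt (measurable_fst.comp measurable_fst) measurable_snd
    have h2 : S = (Prod.fst ⁻¹' A) ∩ {p : (ℝ × Fin K) × ℝ | p.1.1 < p.2} := by
      ext p
      simp [hS, hA, and_assoc]
    rw [h2]
    exact (measurable_fst hAm).inter h1
  set f : (ℝ × Fin K) × ℝ → ℝ := S.indicator (fun p => 1 / G p.1.1) with hf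
  have hfm : Measurable f :=
    ((hGm.comp (measurable_fst.comp measurable_fst)).const_div 1).indicator hSm
  have hint : Integrable f ((P.map (fun ω => (T ω, Δ ω))).prod (P.map C)) := by
    refine Integrable.of_bound hfm.aestronglyMeasurable (1 / G ζ) (Filter.Eventually.of_forall ?_)
    intro p
    by_cases hp : p ∈ S
    · have h1 : G ζ ≤ G p.1.1 := hanti hp.1
      rw [hf, Set.indicator_of_mem hp, Real.norm_of_nonneg
        (one_div_nonneg.2 (hGζ.le.trans h1))]
      exact one_div_le_one_div_of_le hGζ h1
    · rw [hf, Set.indicator_of_notMem hp, norm_zero]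
      exact one_div_nonneg.2 hGζ.le
  have hinner : ∀ x : ℝ × Fin K, ∫ c, f (x, c) ∂(P.map C) = A.indicator 1 x := by
    intro x
    by_cases hx : x ∈ A
    · have h1 : 0 < G x.1 := hGζ.trans_le (hanti hx.1)
      have h2 : (fun c => f (x, c)) = (Set.Ioi x.1).indicator (fun _ => 1 / G x.1) := by
        ext c
        simp only [hf, Set.indicator_apply]
        have : (x, c) ∈ S ↔ c ∈ Set.Ioi x.1 :=
          ⟨fun h => h.2.2, fun h => ⟨hx.1, hx.2, h⟩⟩
        simp only [this]
      have h3 : (P.map C).real (Set.Ioi x.1) = G x.1 := by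
        rw [measureReal_def, Measure.map_apply hC measurableSet_Ioi, hG]
        rfl
      rw [h2, integral_indicator_const _ measurableSet_Ioi, h3, Set.indicator_of_mem hx,
        smul_eq_mul, mul_one_div_cancel h1.ne', Pi.one_apply]
    · rw [Set.indicator_of_notMem hx]
      have h2 : (fun c => f (x, c)) = fun _ => 0 := by
        ext c
        exact Set.indicator_of_notMem (fun h => hx ⟨h.1, h.2.1⟩) _
      rw [h2, integral_zero]
  have hmain : ∫ ω, f ((T ω, Δ ω), C ω) ∂P = F k ζ := by
    rw [← integral_map (φ := fun ω => ((T ω, Δ ω), C ω)) (hX.prodMk hC).aemeasurable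
      hfm.aestronglyMeasurable, hmap, integral_prod _ hint]
    simp_rw [hinner]
    rw [integral_indicator_one hAm, measureReal_def, Measure.map_apply hX hAm, hF]
    rfl
  exact hmain
end

section
/- (IPCW identity for the competing-event term Φ) Fix a time horizon ζ ∈ ℝ with G(ζ) > 0. Then for every event index k ∈ Fin K, the inverse-probability-of-censoring-weighted indicator that some event other than k occurred uncensored by ζ integrates to the corresponding latent probability: ∫_Ω 1{T(ω) ≤ ζ ∧ Δ(ω) ≠ k ∧ T(ω) < C(ω)} / G(T(ω)) dℙ(ω) = ℙ(T ≤ ζ ∧ Δ ≠ k). -/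
open MeasureTheory ProbabilityTheory

/-- (IPCW identity for the competing-event term Φ) For a horizon `ζ` with `G ζ > 0`
and every event index `k`, the IPCW-reweighted indicator that some event other than
`k` occurred uncensored by `ζ` integrates to `P(T ≤ ζ ∧ Δ ≠ k)`. -/
theorem ipcw_competing_term
    {Ω : Type*} [MeasurableSpace Ω] (P : Measure Ω) [IsProbabilityMeasure P]
    {K : ℕ} (hK : 1 ≤ K)
    (T : Ω → ℝ) (Δ : Ω → Fin K) (C : Ω → ℝ)
    (hT : Measurable T) (hΔ : Measurable Δ) (hC : Measurable C)
    (hindep : IndepFun (fun ω => (T ω, Δ ω)) C P)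
    (G : ℝ → ℝ) (hG : ∀ t, G t = (P {ω | t < C ω}).toReal)
    (ζ : ℝ) (hGζ : 0 < G ζ) (k : Fin K) :
    ∫ ω, Set.indicator {ω' | T ω' ≤ ζ ∧ Δ ω' ≠ k ∧ T ω' < C ω'}
        (fun ω' => 1 / G (T ω')) ω ∂P
      = (P {ω | T ω ≤ ζ ∧ Δ ω ≠ k}).toReal := by
  have hanti : Antitone G := by
    intro a b hab
    rw [hG, hG]
    exact ENNReal.toReal_mono (measure_ne_top _ _)
      (measure_mono fun ω (h : b < C ω) => lt_of_le_of_lt hab h)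
  have hGm : Measurable G := hanti.measurable
  let X : Ω → ℝ × Fin K := fun ω => (T ω, Δ ω)
  have hX : Measurable X := hT.prodMk hΔ
  let A : Set (ℝ × Fin K) := {x | x.1 ≤ ζ ∧ x.2 ≠ k}
  have hA : MeasurableSet A := by
    have h1 : MeasurableSet {x : ℝ × Fin K | x.1 ≤ ζ} :=
      measurableSet_le measurable_fst measurable_const
    have h2 : MeasurableSet {x : ℝ × Fin K | x.2 ≠ k} :=
      measurable_snd (MeasurableSet.of_discrete (s := {j : Fin K | j ≠ k}))
    exact h1.inter h2
  let S : Set ((ℝ × Fin K) × ℝ) := {p | p.1.1 ≤ ζ ∧ p.1.2 ≠ k ∧ p.1.1 < p.2}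
  have hS : MeasurableSet S := by
    have h1 : MeasurableSet {p : (ℝ × Fin K) × ℝ | p.1.1 < p.2} :=
      measurableSet_lt (measurable_fst.comp measurable_fst) measurable_snd
    have h2 : S = (Prod.fst ⁻¹' A) ∩ {p : (ℝ × Fin K) × ℝ | p.1.1 < p.2} := by
      ext p
      simp [S, A, and_assoc]
    rw [h2]
    exact (measurable_fst hA).inter h1
  let f : (ℝ × Fin K) × ℝ → ℝ := S.indicator (fun p => 1 / G p.1.1)
  have hf : Measurable f :=
    (measurable_const.div (hGm.comp (measurable_fst.comp measurable_fst))).indicator hS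
  have hmap := (indepFun_iff_map_prod_eq_prod_map_map hX.aemeasurable hC.aemeasurable).1 hindep
  have hPX : IsProbabilityMeasure (P.map X) := Measure.isProbabilityMeasure_map hX.aemeasurable
  have hPC : IsProbabilityMeasure (P.map C) := Measure.isProbabilityMeasure_map hC.aemeasurable
  have hint : Integrable f ((P.map X).prod (P.map C)) := by
    refine Integrable.of_bound hf.aestronglyMeasurable (1 / G ζ) (ae_of_all _ fun p => ?_)
    by_cases hp : p ∈ S
    · have h1 : G ζ ≤ G p.1.1 := hanti hp.1
      have h2 : 0 < G p.1.1 := hGζ.trans_le h1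
      simp only [f, Set.indicator_of_mem hp]
      rw [Real.norm_of_nonneg (by positivity)]
      exact one_div_le_one_div_of_le hGζ h1
    · simp only [f, Set.indicator_of_notMem hp, norm_zero]
      positivity
  have hinner : ∀ x, ∫ c, f (x, c) ∂(P.map C) = A.indicator 1 x := by
    intro x
    by_cases hx : x ∈ A
    · have h2 : 0 < G x.1 := hGζ.trans_le (hanti hx.1)
      have h3 : (fun c => f (x, c)) = (Set.Ioi x.1).indicator (fun _ => 1 / G x.1) := by
        funext c
        by_cases hc : x.1 < c
        · rw [Set.indicator_of_mem (show c ∈ Set.Ioi x.1 from hc)]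
          exact Set.indicator_of_mem (show (x, c) ∈ S from ⟨hx.1, hx.2, hc⟩) _
        · rw [Set.indicator_of_notMem (show c ∉ Set.Ioi x.1 from hc)]
          exact Set.indicator_of_notMem (show (x, c) ∉ S from fun h => hc h.2.2) _
      have h4 : (P.map C).real (Set.Ioi x.1) = G x.1 := by
        rw [hG, Measure.real, Measure.map_apply hC measurableSet_Ioi]
        rfl
      rw [h3, integral_indicator_const _ measurableSet_Ioi, h4, Set.indicator_of_mem hx]
      simp [h2.ne']
    · have h3 : (fun c => f (x, c)) = fun _ => 0 := by
        funext c
        exact Set.indicator_of_notMem (show (x, c) ∉ S from fun h => hx ⟨h.1, h.2.1⟩) _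
      rw [h3, Set.indicator_of_notMem hx, integral_zero]
  calc _ = ∫ ω, f (X ω, C ω) ∂P := rfl
    _ = ∫ p, f p ∂(P.map (fun ω => (X ω, C ω))) :=
        (integral_map (hX.prodMk hC).aemeasurable hf.aestronglyMeasurable).symm
    _ = ∫ p, f p ∂((P.map X).prod (P.map C)) := by rw [hmap]
    _ = ∫ x, ∫ c, f (x, c) ∂(P.map C) ∂(P.map X) := integral_prod _ hint
    _ = ∫ x, A.indicator 1 x ∂(P.map X) := by simp_rw [hinner]
    _ = (P.map X).real A := integral_indicator_one hA
    _ = _ := by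
        rw [Measure.real, Measure.map_apply hX hA]
        rfl
end

section
/- (Lemma 1: expectation of the censoring-reweighted negative log-likelihood) Fix a time horizon ζ ∈ ℝ with G(ζ) > 0, and fix candidate values p : Fin K → ℝ with p_k > 0 for all k and s > 0. Define the pointwise score L(ω) = Σ_{k ∈ Fin K} 1{T(ω) ≤ ζ ∧ Δ(ω) = k ∧ T(ω) < C(ω)} · log(p_k) / G(T(ω)) + 1{T(ω) > ζ ∧ C(ω) > ζ} · log(s) / G(ζ). Then ∫_Ω L dℙ = Σ_{k ∈ Fin K} log(p_k) · F_k(ζ) + log(s) · S(ζ). -/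
open MeasureTheory ProbabilityTheory

/-- (Lemma 1: expectation of the censoring-reweighted negative log-likelihood)
For a horizon `ζ` with `G ζ > 0` and positive candidate values `p k` and `s`,
the expectation of the pointwise reweighted log-score equals
`∑ k, log (p k) * F k ζ + log s * S ζ`. -/
theorem expectation_reweighted_logloss
    {Ω : Type*} [MeasurableSpace Ω] (P : Measure Ω) [IsProbabilityMeasure P]
    {K : ℕ} (hK : 1 ≤ K)
    (T : Ω → ℝ) (Δ : Ω → Fin K) (C : Ω → ℝ)
    (hT : Measurable T) (hΔ : Measurable Δ) (hC : Measurable C)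
    (hindep : IndepFun (fun ω => (T ω, Δ ω)) C P)
    (G : ℝ → ℝ) (hG : ∀ t, G t = (P {ω | t < C ω}).toReal)
    (F : Fin K → ℝ → ℝ)
    (hF : ∀ k t, F k t = (P {ω | T ω ≤ t ∧ Δ ω = k}).toReal)
    (S : ℝ → ℝ) (hS : ∀ t, S t = (P {ω | t < T ω}).toReal)
    (ζ : ℝ) (hGζ : 0 < G ζ)
    (p : Fin K → ℝ) (hp : ∀ k, 0 < p k) (s : ℝ) (hs : 0 < s) :
    ∫ ω, ((∑ k : Fin K, Set.indicator {ω' | T ω' ≤ ζ ∧ Δ ω' = k ∧ T ω' < C ω'}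
            (fun ω' => Real.log (p k) / G (T ω')) ω)
          + Set.indicator {ω' | ζ < T ω' ∧ ζ < C ω'}
            (fun _ => Real.log s / G ζ) ω) ∂P
      = (∑ k : Fin K, Real.log (p k) * F k ζ) + Real.log s * S ζ := by
  classical
  have hanti : Antitone G := by
    intro a b hab
    rw [hG, hG]
    exact ENNReal.toReal_mono (measure_ne_top _ _)
      (measure_mono fun ω (h : b < C ω) => lt_of_le_of_lt hab h)
  have hGm : Measurable G := hanti.measurable
  have hX : Measurable (fun ω => (T ω, Δ ω)) := hT.prodMk hΔ
  have hmeasA : ∀ k, MeasurableSet {ω' | T ω' ≤ ζ ∧ Δ ω' = k ∧ T ω' < C ω'} := fun k =>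
    (measurableSet_le hT measurable_const).inter
      ((hΔ (measurableSet_singleton k)).inter (measurableSet_lt hT hC))
  have hint : ∀ k, Integrable (Set.indicator {ω' | T ω' ≤ ζ ∧ Δ ω' = k ∧ T ω' < C ω'}
            (fun ω' => Real.log (p k) / G (T ω'))) P := by
    intro k
    refine Integrable.of_bound (C := |Real.log (p k)| / G ζ)
      ((measurable_const.div (hGm.comp hT)).indicator (hmeasA k)).aestronglyMeasurable ?_
    refine Filter.Eventually.of_forall fun ω => ?_
    by_cases h : ω ∈ {ω' | T ω' ≤ ζ ∧ Δ ω' = k ∧ T ω' < C ω'}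
    · rw [Set.indicator_of_mem h]
      have h1 : G ζ ≤ G (T ω) := hanti h.1
      rw [Real.norm_eq_abs, abs_div, abs_of_pos (hGζ.trans_le h1)]
      gcongr
    · rw [Set.indicator_of_notMem h, norm_zero]
      positivity
  have hval : ∀ k, ∫ ω, Set.indicator {ω' | T ω' ≤ ζ ∧ Δ ω' = k ∧ T ω' < C ω'}
            (fun ω' => Real.log (p k) / G (T ω')) ω ∂P = Real.log (p k) * F k ζ := by
    intro k
    have hmap := (indepFun_iff_map_prod_eq_prod_map_map hX.aemeasurable hC.aemeasurable).1 hindep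
    have : IsProbabilityMeasure (P.map (fun ω => (T ω, Δ ω))) :=
      Measure.isProbabilityMeasure_map hX.aemeasurable
    have : IsProbabilityMeasure (P.map C) :=
      Measure.isProbabilityMeasure_map hC.aemeasurable
    let f : (ℝ × Fin K) × ℝ → ℝ := Set.indicator {z | z.1.1 ≤ ζ ∧ z.1.2 = k ∧ z.1.1 < z.2}
      (fun z => Real.log (p k) / G z.1.1)
    have hfm : Measurable f := by
      refine (measurable_const.div (hGm.comp (measurable_fst.comp measurable_fst))).indicator ?_
      exact (measurableSet_le (measurable_fst.comp measurable_fst) measurable_const).inter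
        (((measurable_snd.comp measurable_fst) (measurableSet_singleton k)).inter
          (measurableSet_lt (measurable_fst.comp measurable_fst) measurable_snd))
    have hXC : Measurable (fun ω => ((T ω, Δ ω), C ω)) := hX.prodMk hC
    have hfi : Integrable f ((P.map (fun ω => (T ω, Δ ω))).prod (P.map C)) := by
      rw [← hmap]
      exact (integrable_map_measure hfm.aestronglyMeasurable hXC.aemeasurable).2 (hint k)
    have e1 : ∫ ω, Set.indicator {ω' | T ω' ≤ ζ ∧ Δ ω' = k ∧ T ω' < C ω'}
            (fun ω' => Real.log (p k) / G (T ω')) ω ∂P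
        = ∫ z, f z ∂((P.map (fun ω => (T ω, Δ ω))).prod (P.map C)) := by
      rw [← hmap, integral_map hXC.aemeasurable hfm.aestronglyMeasurable]
      rfl
    have hB : MeasurableSet {x : ℝ × Fin K | x.1 ≤ ζ ∧ x.2 = k} :=
      (measurableSet_le measurable_fst measurable_const).inter
        (measurable_snd (measurableSet_singleton k))
    have e2 : ∀ x : ℝ × Fin K, ∫ c, f (x, c) ∂(P.map C)
        = Set.indicator {x : ℝ × Fin K | x.1 ≤ ζ ∧ x.2 = k} (fun _ => Real.log (p k)) x := by
      intro x
      by_cases h : x.1 ≤ ζ ∧ x.2 = k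
      · have h0 : G x.1 ≠ 0 := (hGζ.trans_le (hanti h.1)).ne'
        have : (fun c => f (x, c)) = Set.indicator (Set.Ioi x.1)
            (fun _ => Real.log (p k) / G x.1) := by
          funext c
          simp [f, Set.indicator_apply, h.1, h.2]
        rw [this, integral_indicator_const _ measurableSet_Ioi,
          Set.indicator_of_mem (show x ∈ {x : ℝ × Fin K | x.1 ≤ ζ ∧ x.2 = k} from h),
          map_measureReal_apply hC measurableSet_Ioi]
        have : P.real (C ⁻¹' Set.Ioi x.1) = G x.1 := by rw [hG]; rfl
        rw [this, smul_eq_mul]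
        field_simp
      · have : (fun c => f (x, c)) = fun _ => 0 := by
          funext c
          refine Set.indicator_of_notMem ?_ _
          exact fun hc => h ⟨hc.1, hc.2.1⟩
        rw [this, integral_zero, Set.indicator_of_notMem]
        exact h
    rw [e1, integral_prod _ hfi]
    simp_rw [e2]
    rw [integral_indicator_const _ hB, map_measureReal_apply hX hB, hF, smul_eq_mul, mul_comm]
    rfl
  have hD : MeasurableSet {ω' | ζ < T ω' ∧ ζ < C ω'} :=
    (measurableSet_lt measurable_const hT).inter (measurableSet_lt measurable_const hC)
  rw [integral_add (integrable_finsetSum _ fun k _ => hint k)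
    ((integrable_const _).indicator hD), integral_finsetSum _ fun k _ => hint k,
    integral_indicator_const _ hD]
  simp_rw [hval]
  congr 1
  have h1 : P {ω' | ζ < T ω' ∧ ζ < C ω'} = P {ω | ζ < T ω} * P {ω | ζ < C ω} :=
    hindep.measure_inter_preimage_eq_mul (Prod.fst ⁻¹' Set.Ioi ζ) (Set.Ioi ζ)
      (measurable_fst measurableSet_Ioi) measurableSet_Ioi
  rw [measureReal_def, h1, ENNReal.toReal_mul, ← hG, ← hS, smul_eq_mul]
  field_simp
end

section
/- (Theorem 1, inequality part: properness of the reweighted log-loss scoring rule) Fix a time horizon ζ ∈ ℝ with G(ζ) > 0, and assume F_k(ζ) > 0 for every k ∈ Fin K and S(ζ) > 0. For candidate values p : Fin K → ℝ and s ∈ ℝ with p_k > 0 for all k, s > 0 and Σ_{k} p_k + s = 1, define the pointwise score L(p, s)(ω) = Σ_{k ∈ Fin K} 1{T(ω) ≤ ζ ∧ Δ(ω) = k ∧ T(ω) < C(ω)} · log(p_k) / G(T(ω)) + 1{T(ω) > ζ ∧ C(ω) > ζ} · log(s) / G(ζ). Then the expected score of any candidate is at most the expected score of the oracle: ∫_Ω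 L(p, s) dℙ ≤ ∫_Ω L((F_k(ζ))_{k ∈ Fin K}, S(ζ)) dℙ. -/
open MeasureTheory ProbabilityTheory

/-- The pointwise censoring-reweighted log-likelihood score of candidate
probabilities `p : Fin K → ℝ` (for the K cumulative incidences) and `s : ℝ`
(for survival) at the time horizon `ζ`. -/
noncomputable def reweightedScore {Ω : Type*} {K : ℕ}
    (T : Ω → ℝ) (Δ : Ω → Fin K) (C : Ω → ℝ) (G : ℝ → ℝ) (ζ : ℝ)
    (p : Fin K → ℝ) (s : ℝ) (ω : Ω) : ℝ :=
  (∑ k : Fin K, Set.indicator {ω' | T ω' ≤ ζ ∧ Δ ω' = k ∧ T ω' < C ω'}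
      (fun ω' => Real.log (p k) / G (T ω')) ω)
  + Set.indicator {ω' | ζ < T ω' ∧ ζ < C ω'} (fun _ => Real.log s / G ζ) ω

theorem aux_meas_G {Ω : Type*} [MeasurableSpace Ω] (P : Measure Ω) [IsProbabilityMeasure P]
    (C : Ω → ℝ) (G : ℝ → ℝ) (hG : ∀ t, G t = (P {ω | t < C ω}).toReal) : Antitone G := by
  intro a b hab
  rw [hG, hG]
  exact ENNReal.toReal_mono (measure_ne_top _ _)
    (measure_mono fun ω (h : b < C ω) => lt_of_le_of_lt hab h)

theorem aux_bound {G : ℝ → ℝ} (hA : Antitone G) {ζ : ℝ} (hGζ : 0 < G ζ) (c : ℝ) {t : ℝ}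
    (ht : t ≤ ζ) : ‖c / G t‖ ≤ |c| / G ζ := by
  have h1 : G ζ ≤ G t := hA ht
  rw [Real.norm_eq_abs, abs_div, abs_of_pos (lt_of_lt_of_le hGζ h1)]
  exact div_le_div_of_nonneg_left (abs_nonneg _) hGζ h1

theorem aux_term {Ω : Type*} [MeasurableSpace Ω] (P : Measure Ω) [IsProbabilityMeasure P]
    {K : ℕ} (T : Ω → ℝ) (Δ : Ω → Fin K) (C : Ω → ℝ)
    (hT : Measurable T) (hΔ : Measurable Δ) (hC : Measurable C)
    (hindep : IndepFun (fun ω => (T ω, Δ ω)) C P)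
    (G : ℝ → ℝ) (hG : ∀ t, G t = (P {ω | t < C ω}).toReal)
    (ζ : ℝ) (hGζ : 0 < G ζ) (k : Fin K) (c : ℝ) :
    Integrable (fun ω => Set.indicator {ω' | T ω' ≤ ζ ∧ Δ ω' = k ∧ T ω' < C ω'}
      (fun ω' => c / G (T ω')) ω) P ∧
    ∫ ω, Set.indicator {ω' | T ω' ≤ ζ ∧ Δ ω' = k ∧ T ω' < C ω'}
      (fun ω' => c / G (T ω')) ω ∂P = (P {ω | T ω ≤ ζ ∧ Δ ω = k}).toReal * c := by
  have hA := aux_meas_G P C G hG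
  have hGm : Measurable G := hA.measurable
  have hTD : Measurable (fun ω => (T ω, Δ ω)) := hT.prodMk hΔ
  have hprod := (indepFun_iff_map_prod_eq_prod_map_map hTD.aemeasurable hC.aemeasurable).1 hindep
  set μ := P.map (fun ω => (T ω, Δ ω)) with hμ
  set ν := P.map C with hν
  haveI : IsProbabilityMeasure μ := Measure.isProbabilityMeasure_map hTD.aemeasurable
  haveI : IsProbabilityMeasure ν := Measure.isProbabilityMeasure_map hC.aemeasurable
  let A : Set ((ℝ × Fin K) × ℝ) := {x | x.1.1 ≤ ζ ∧ x.1.2 = k ∧ x.1.1 < x.2}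
  let B : Set (ℝ × Fin K) := {x | x.1 ≤ ζ ∧ x.2 = k}
  have hBm : MeasurableSet B :=
    (measurableSet_le measurable_fst measurable_const).inter
      (measurable_snd (measurableSet_singleton k))
  have hAm : MeasurableSet A := by
    refine (measurableSet_le (measurable_fst.comp measurable_fst) measurable_const).inter
      (MeasurableSet.inter ?_ ?_)
    · exact (measurable_snd.comp measurable_fst) (measurableSet_singleton k)
    · exact measurableSet_lt (measurable_fst.comp measurable_fst) measurable_snd
  let g : (ℝ × Fin K) × ℝ → ℝ := A.indicator (fun x => c / G x.1.1)
  have hgm : Measurable g :=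
    (measurable_const.div (hGm.comp (measurable_fst.comp measurable_fst))).indicator hAm
  have hgb : ∀ x, ‖g x‖ ≤ |c| / G ζ := by
    intro x
    by_cases hx : x ∈ A
    · simp only [g, Set.indicator_of_mem hx]
      exact aux_bound hA hGζ c hx.1
    · simp only [g, Set.indicator_of_notMem hx, norm_zero]
      positivity
  have hgi : Integrable g (μ.prod ν) :=
    Integrable.of_bound hgm.aestronglyMeasurable _ (Filter.Eventually.of_forall hgb)
  have hpair : Measurable (fun ω => ((T ω, Δ ω), C ω)) := hTD.prodMk hC
  have hfun : (fun ω => Set.indicator {ω' | T ω' ≤ ζ ∧ Δ ω' = k ∧ T ω' < C ω'}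
      (fun ω' => c / G (T ω')) ω) = fun ω => g ((T ω, Δ ω), C ω) := by
    funext ω
    simp only [g, A, Set.indicator, Set.mem_setOf_eq]
  rw [hfun]
  rw [← hprod] at hgi
  refine ⟨hgi.comp_measurable hpair, ?_⟩
  have e1 : ∫ ω, g ((T ω, Δ ω), C ω) ∂P = ∫ x, g x ∂(P.map (fun ω => ((T ω, Δ ω), C ω))) :=
    (integral_map hpair.aemeasurable hgm.aestronglyMeasurable).symm
  rw [e1]
  rw [hprod] at hgi ⊢
  rw [integral_prod _ hgi]
  have inner : ∀ x : ℝ × Fin K, ∫ y, g (x, y) ∂ν = B.indicator (fun _ => c) x := by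
    intro x
    by_cases hx : x ∈ B
    · have : (fun y => g (x, y)) = (Set.Ioi x.1).indicator (fun _ => c / G x.1) := by
        funext y
        have : ((x, y) ∈ A) ↔ y ∈ Set.Ioi x.1 :=
          ⟨fun h => h.2.2, fun h => ⟨hx.1, hx.2, h⟩⟩
        simp only [g, Set.indicator, this]
      rw [this, integral_indicator measurableSet_Ioi, setIntegral_const, Set.indicator_of_mem hx]
      have hv : ν.real (Set.Ioi x.1) = G x.1 := by
        rw [hG, measureReal_def, hν, Measure.map_apply hC measurableSet_Ioi]
        rfl
      have hpos : 0 < G x.1 := lt_of_lt_of_le hGζ (hA hx.1)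
      rw [hv, smul_eq_mul]
      field_simp
    · have : (fun y => g (x, y)) = fun _ => 0 := by
        funext y
        exact Set.indicator_of_notMem (fun h => hx ⟨h.1, h.2.1⟩) _
      rw [this, Set.indicator_of_notMem hx]
      simp
  simp_rw [inner]
  rw [integral_indicator hBm, setIntegral_const, smul_eq_mul, measureReal_def, hμ,
    Measure.map_apply hTD hBm]
  rfl

theorem aux_surv {Ω : Type*} [MeasurableSpace Ω] (P : Measure Ω) [IsProbabilityMeasure P]
    {K : ℕ} (T : Ω → ℝ) (Δ : Ω → Fin K) (C : Ω → ℝ)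
    (hT : Measurable T) (hC : Measurable C)
    (hindep : IndepFun (fun ω => (T ω, Δ ω)) C P)
    (G : ℝ → ℝ) (hG : ∀ t, G t = (P {ω | t < C ω}).toReal)
    (ζ : ℝ) (hGζ : 0 < G ζ) (c : ℝ) :
    Integrable (fun ω => Set.indicator {ω' | ζ < T ω' ∧ ζ < C ω'} (fun _ => c / G ζ) ω) P ∧
    ∫ ω, Set.indicator {ω' | ζ < T ω' ∧ ζ < C ω'} (fun _ => c / G ζ) ω ∂P
      = (P {ω | ζ < T ω}).toReal * c := by
  have hm : MeasurableSet {ω' | ζ < T ω' ∧ ζ < C ω'} :=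
    (measurableSet_lt measurable_const hT).inter (measurableSet_lt measurable_const hC)
  refine ⟨(integrable_const _).indicator hm, ?_⟩
  have hTC : IndepFun T C P := hindep.comp (φ := Prod.fst) (ψ := id) measurable_fst measurable_id
  have := hTC.measure_inter_preimage_eq_mul (Set.Ioi ζ) (Set.Ioi ζ)
    measurableSet_Ioi measurableSet_Ioi
  have h2 : P {ω' | ζ < T ω' ∧ ζ < C ω'} = P {ω | ζ < T ω} * P {ω | ζ < C ω} := this
  rw [integral_indicator hm, setIntegral_const, smul_eq_mul, measureReal_def, h2,
    ENNReal.toReal_mul, ← hG]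
  field_simp

theorem aux_score {Ω : Type*} [MeasurableSpace Ω] (P : Measure Ω) [IsProbabilityMeasure P]
    {K : ℕ} (T : Ω → ℝ) (Δ : Ω → Fin K) (C : Ω → ℝ)
    (hT : Measurable T) (hΔ : Measurable Δ) (hC : Measurable C)
    (hindep : IndepFun (fun ω => (T ω, Δ ω)) C P)
    (G : ℝ → ℝ) (hG : ∀ t, G t = (P {ω | t < C ω}).toReal)
    (ζ : ℝ) (hGζ : 0 < G ζ) (p : Fin K → ℝ) (s : ℝ) :
    ∫ ω, reweightedScore T Δ C G ζ p s ω ∂P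
      = (∑ k, (P {ω | T ω ≤ ζ ∧ Δ ω = k}).toReal * Real.log (p k))
        + (P {ω | ζ < T ω}).toReal * Real.log s := by
  have h1 := fun k => aux_term P T Δ C hT hΔ hC hindep G hG ζ hGζ k (Real.log (p k))
  have h2 := aux_surv P T Δ C hT hC hindep G hG ζ hGζ (Real.log s)
  unfold reweightedScore
  rw [integral_add (integrable_finsetSum _ fun k _ => (h1 k).1) h2.1,
    integral_finsetSum _ fun k _ => (h1 k).1, h2.2]
  simp_rw [fun k => (h1 k).2]

theorem aux_gibbs {a q : ℝ} (ha : 0 < a) (hq : 0 < q) :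
    a * Real.log q ≤ a * Real.log a + (q - a) := by
  have h := Real.log_le_sub_one_of_pos (div_pos hq ha)
  rw [Real.log_div hq.ne' ha.ne'] at h
  have h3 := mul_le_mul_of_nonneg_left h ha.le
  have h4 : a * (q / a - 1) = q - a := by field_simp
  rw [h4] at h3
  linarith

/-- (Theorem 1, inequality part: properness of the reweighted log-loss scoring
rule) Any candidate `(p, s)` in the open probability simplex has expected score
at most the expected score of the oracle `((F k ζ)_k, S ζ)`. -/
theorem reweighted_logloss_proper
    {Ω : Type*} [MeasurableSpace Ω] (P : Measure Ω) [IsProbabilityMeasure P]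
    {K : ℕ} (hK : 1 ≤ K)
    (T : Ω → ℝ) (Δ : Ω → Fin K) (C : Ω → ℝ)
    (hT : Measurable T) (hΔ : Measurable Δ) (hC : Measurable C)
    (hindep : IndepFun (fun ω => (T ω, Δ ω)) C P)
    (G : ℝ → ℝ) (hG : ∀ t, G t = (P {ω | t < C ω}).toReal)
    (F : Fin K → ℝ → ℝ)
    (hF : ∀ k t, F k t = (P {ω | T ω ≤ t ∧ Δ ω = k}).toReal)
    (S : ℝ → ℝ) (hS : ∀ t, S t = (P {ω | t < T ω}).toReal)
    (ζ : ℝ) (hGζ : 0 < G ζ)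
    (hFpos : ∀ k, 0 < F k ζ) (hSpos : 0 < S ζ)
    (p : Fin K → ℝ) (s : ℝ)
    (hp : ∀ k, 0 < p k) (hs : 0 < s) (hsum : (∑ k : Fin K, p k) + s = 1) :
    ∫ ω, reweightedScore T Δ C G ζ p s ω ∂P
      ≤ ∫ ω, reweightedScore T Δ C G ζ (fun k => F k ζ) (S ζ) ω ∂P := by
  rw [aux_score P T Δ C hT hΔ hC hindep G hG ζ hGζ, aux_score P T Δ C hT hΔ hC hindep G hG ζ hGζ]
  simp_rw [← hF, ← hS]
  have hone : 1 ≤ (∑ k, F k ζ) + S ζ := by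
    have hu : (Set.univ : Set Ω) ⊆ (⋃ k ∈ Finset.univ, {ω | T ω ≤ ζ ∧ Δ ω = k}) ∪ {ω | ζ < T ω} := by
      intro ω _
      rcases le_or_gt (T ω) ζ with h | h
      · left
        simp [h]
      · right
        exact h
    have h1 : P.real Set.univ ≤ _ := (measureReal_mono hu).trans (measureReal_union_le _ _)
    have h2 := measureReal_biUnion_finset_le (μ := P) Finset.univ
      (fun k => {ω | T ω ≤ ζ ∧ Δ ω = k})
    rw [probReal_univ] at h1
    simp only [measureReal_def, ← hF, ← hS] at h1 h2
    linarith
  have hk : ∑ k, F k ζ * Real.log (p k) ≤ ∑ k, (F k ζ * Real.log (F k ζ) + (p k - F k ζ)) :=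
    Finset.sum_le_sum fun k _ => aux_gibbs (hFpos k) (hp k)
  rw [Finset.sum_add_distrib, Finset.sum_sub_distrib] at hk
  have hs' := aux_gibbs hSpos hs
  linarith
end

section
/- (Theorem 1, strictness part: the reweighted log-loss is strictly proper) Fix a time horizon ζ ∈ ℝ with G(ζ) > 0, and assume F_k(ζ) > 0 for every k ∈ Fin K and S(ζ) > 0. For candidate values p : Fin K → ℝ and s ∈ ℝ with p_k > 0 for all k, s > 0 and Σ_{k} p_k + s = 1, define L(p, s)(ω) = Σ_{k ∈ Fin K} 1{T(ω) ≤ ζ ∧ Δ(ω) = k ∧ T(ω) < C(ω)} · log(p_k) / G(T(ω)) + 1{T(ω) > ζ ∧ C(ω) > ζ} · log(s) / G(ζ). Then ∫_Ω L(p, s) dℙ = ∫_Ω L((F_k(ζ))_k, S(ζ)) dℙ if and only if p_k = F_k(ζ) for every k ∈ Fin K and s = S(ζ). -/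
open MeasureTheory ProbabilityTheory

theorem gibbs_term {a b : ℝ} (ha : 0 < a) (hb : 0 < b) :
    0 ≤ b - a - a * (Real.log b - Real.log a) ∧
    (b - a - a * (Real.log b - Real.log a) = 0 → b = a) := by
  have hq : 0 < b / a := div_pos hb ha
  rw [← Real.log_div hb.ne' ha.ne']
  have e : a * (b / a) = b := by field_simp
  constructor
  · have := Real.log_le_sub_one_of_pos hq
    nlinarith
  · intro h
    by_contra hne
    have hne' : b / a ≠ 1 := by
      intro h1
      exact hne ((div_eq_one_iff_eq ha.ne').1 h1)
    have := Real.log_lt_sub_one_of_pos hq hne'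
    nlinarith

theorem ipcw_aux
    {Ω : Type*} [MeasurableSpace Ω] (P : Measure Ω) [IsProbabilityMeasure P]
    {K : ℕ} (T : Ω → ℝ) (Δ : Ω → Fin K) (C : Ω → ℝ)
    (hT : Measurable T) (hΔ : Measurable Δ) (hC : Measurable C)
    (hindep : IndepFun (fun ω => (T ω, Δ ω)) C P)
    (G : ℝ → ℝ) (hG : ∀ t, G t = (P {ω | t < C ω}).toReal)
    (ζ : ℝ) (hGζ : 0 < G ζ) (k : Fin K) (a : ℝ) :
    Integrable (Set.indicator {ω' | T ω' ≤ ζ ∧ Δ ω' = k ∧ T ω' < C ω'}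
      (fun ω' => a / G (T ω'))) P ∧
    ∫ ω, Set.indicator {ω' | T ω' ≤ ζ ∧ Δ ω' = k ∧ T ω' < C ω'}
      (fun ω' => a / G (T ω')) ω ∂P = (P {ω | T ω ≤ ζ ∧ Δ ω = k}).toReal * a := by
  have hanti : Antitone G := by
    intro x y hxy
    rw [hG, hG]
    exact ENNReal.toReal_mono (measure_ne_top _ _)
      (measure_mono fun ω (h : y < C ω) => lt_of_le_of_lt hxy h)
  have hGm : Measurable G := hanti.measurable
  let A : Set ((ℝ × Fin K) × ℝ) := {z | z.1.1 ≤ ζ ∧ z.1.2 = k ∧ z.1.1 < z.2}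
  have hA : MeasurableSet A := by
    refine (measurableSet_le (measurable_fst.comp measurable_fst) measurable_const).inter
      (MeasurableSet.inter ?_ (measurableSet_lt (measurable_fst.comp measurable_fst) measurable_snd))
    exact (measurable_snd.comp measurable_fst) (measurableSet_singleton k)
  let f : (ℝ × Fin K) × ℝ → ℝ := A.indicator fun z => a / G z.1.1
  have hf : Measurable f := Measurable.indicator (by fun_prop) hA
  have hTD : Measurable fun ω => (T ω, Δ ω) := hT.prodMk hΔ
  have hφ : Measurable fun ω => ((T ω, Δ ω), C ω) := hTD.prodMk hC
  have hbd : ∀ z, ‖f z‖ ≤ |a| / G ζ := by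
    intro z
    by_cases hz : z ∈ A
    · have h1 : G ζ ≤ G z.1.1 := hanti hz.1
      simp only [f, Set.indicator_of_mem hz, Real.norm_eq_abs, abs_div]
      rw [abs_of_pos (hGζ.trans_le h1)]
      gcongr
    · simp only [f, Set.indicator_of_notMem hz, norm_zero]
      positivity
  have hcomp : (Set.indicator {ω' | T ω' ≤ ζ ∧ Δ ω' = k ∧ T ω' < C ω'}
      (fun ω' => a / G (T ω'))) = fun ω => f ((T ω, Δ ω), C ω) := by
    funext ω
    rfl
  rw [hcomp]
  refine ⟨Integrable.of_bound (hf.comp hφ).aestronglyMeasurable _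
    (Filter.Eventually.of_forall fun ω => hbd _), ?_⟩
  have hmap := (indepFun_iff_map_prod_eq_prod_map_map hTD.aemeasurable hC.aemeasurable).1 hindep
  have : IsProbabilityMeasure (P.map fun ω => (T ω, Δ ω)) :=
    Measure.isProbabilityMeasure_map hTD.aemeasurable
  have : IsProbabilityMeasure (P.map C) := Measure.isProbabilityMeasure_map hC.aemeasurable
  have hB : MeasurableSet {x : ℝ × Fin K | x.1 ≤ ζ ∧ x.2 = k} :=
    (measurableSet_le measurable_fst measurable_const).inter
      (measurable_snd (measurableSet_singleton k))
  rw [← integral_map (f := f) hφ.aemeasurable hf.aestronglyMeasurable, hmap, integral_prod f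
    (Integrable.of_bound hf.aestronglyMeasurable _ (Filter.Eventually.of_forall hbd))]
  have hin : ∀ x : ℝ × Fin K, ∫ c, f (x, c) ∂(P.map C)
      = Set.indicator {x : ℝ × Fin K | x.1 ≤ ζ ∧ x.2 = k} (fun _ => a) x := by
    intro x
    by_cases hx : x.1 ≤ ζ ∧ x.2 = k
    · rw [Set.indicator_of_mem (by exact hx)]
      have h1 : (fun c => f (x, c)) = (Set.Ioi x.1).indicator fun _ => a / G x.1 := by
        funext c
        by_cases hc : x.1 < c
        · rw [Set.indicator_of_mem (by exact hc)]
          exact Set.indicator_of_mem (show (x, c) ∈ A from ⟨hx.1, hx.2, hc⟩) _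
        · rw [Set.indicator_of_notMem (by exact hc)]
          exact Set.indicator_of_notMem (show (x, c) ∉ A from fun h => hc h.2.2) _
      have hpos : 0 < G x.1 := hGζ.trans_le (hanti hx.1)
      have h2 : (P.map C).real (Set.Ioi x.1) = G x.1 := by
        rw [hG, Measure.real, Measure.map_apply hC measurableSet_Ioi]
        rfl
      rw [h1, integral_indicator_const _ measurableSet_Ioi, h2, smul_eq_mul]
      field_simp
    · rw [Set.indicator_of_notMem (by exact hx)]
      have h1 : (fun c => f (x, c)) = fun _ => 0 := by
        funext c
        exact Set.indicator_of_notMem (show (x, c) ∉ A from fun h => hx ⟨h.1, h.2.1⟩) _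
      rw [h1]; simp
  simp_rw [hin]
  rw [integral_indicator_const _ hB, Measure.real, Measure.map_apply hTD hB, smul_eq_mul]
  rfl

theorem surv_aux
    {Ω : Type*} [MeasurableSpace Ω] (P : Measure Ω) [IsProbabilityMeasure P]
    {K : ℕ} (T : Ω → ℝ) (Δ : Ω → Fin K) (C : Ω → ℝ)
    (hT : Measurable T) (hC : Measurable C)
    (hindep : IndepFun (fun ω => (T ω, Δ ω)) C P)
    (G : ℝ → ℝ) (hG : ∀ t, G t = (P {ω | t < C ω}).toReal)
    (ζ : ℝ) (hGζ : 0 < G ζ) (a : ℝ) :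
    Integrable (Set.indicator {ω' | ζ < T ω' ∧ ζ < C ω'} (fun _ => a / G ζ)) P ∧
    ∫ ω, Set.indicator {ω' | ζ < T ω' ∧ ζ < C ω'} (fun _ => a / G ζ) ω ∂P
      = (P {ω | ζ < T ω}).toReal * a := by
  have hm : MeasurableSet {ω' | ζ < T ω' ∧ ζ < C ω'} :=
    (measurableSet_lt measurable_const hT).inter (measurableSet_lt measurable_const hC)
  refine ⟨(integrable_const _).indicator hm, ?_⟩
  have hi : IndepFun T C P := hindep.comp (φ := Prod.fst) (ψ := id) measurable_fst measurable_id
  have h := hi.measure_inter_preimage_eq_mul (Set.Ioi ζ) (Set.Ioi ζ)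
    measurableSet_Ioi measurableSet_Ioi
  have h' : P {ω' | ζ < T ω' ∧ ζ < C ω'} = P {ω | ζ < T ω} * P {ω | ζ < C ω} := h
  rw [integral_indicator_const _ hm, Measure.real, h', ENNReal.toReal_mul, ← hG, smul_eq_mul]
  field_simp

/-- (Theorem 1, strictness part: the reweighted log-loss is strictly proper)
A candidate `(p, s)` in the open probability simplex achieves the oracle
expected score if and only if it equals the oracle `((F k ζ)_k, S ζ)`. -/
theorem reweighted_logloss_strictly_proper
    {Ω : Type*} [MeasurableSpace Ω] (P : Measure Ω) [IsProbabilityMeasure P]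
    {K : ℕ} (hK : 1 ≤ K)
    (T : Ω → ℝ) (Δ : Ω → Fin K) (C : Ω → ℝ)
    (hT : Measurable T) (hΔ : Measurable Δ) (hC : Measurable C)
    (hindep : IndepFun (fun ω => (T ω, Δ ω)) C P)
    (G : ℝ → ℝ) (hG : ∀ t, G t = (P {ω | t < C ω}).toReal)
    (F : Fin K → ℝ → ℝ)
    (hF : ∀ k t, F k t = (P {ω | T ω ≤ t ∧ Δ ω = k}).toReal)
    (S : ℝ → ℝ) (hS : ∀ t, S t = (P {ω | t < T ω}).toReal)
    (ζ : ℝ) (hGζ : 0 < G ζ)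
    (hFpos : ∀ k, 0 < F k ζ) (hSpos : 0 < S ζ)
    (p : Fin K → ℝ) (s : ℝ)
    (hp : ∀ k, 0 < p k) (hs : 0 < s) (hsum : (∑ k : Fin K, p k) + s = 1) :
    ∫ ω, reweightedScore T Δ C G ζ p s ω ∂P
        = ∫ ω, reweightedScore T Δ C G ζ (fun k => F k ζ) (S ζ) ω ∂P
      ↔ (∀ k, p k = F k ζ) ∧ s = S ζ := by
  have hint : ∀ (q : Fin K → ℝ) (r : ℝ), ∫ ω, reweightedScore T Δ C G ζ q r ω ∂P
      = (∑ k, F k ζ * Real.log (q k)) + S ζ * Real.log r := by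
    intro q r
    have h1 := fun k => ipcw_aux P T Δ C hT hΔ hC hindep G hG ζ hGζ k (Real.log (q k))
    have h2 := surv_aux P T Δ C hT hC hindep G hG ζ hGζ (Real.log r)
    unfold reweightedScore
    rw [integral_add (integrable_finsetSum _ fun k _ => (h1 k).1) h2.1,
      integral_finsetSum _ fun k _ => (h1 k).1, h2.2, hS]
    congr 1
    refine Finset.sum_congr rfl fun k _ => ?_
    rw [(h1 k).2, hF]
  have htot : (∑ k, F k ζ) + S ζ = 1 := by
    have hm : ∀ k, MeasurableSet {ω | T ω ≤ ζ ∧ Δ ω = k} := fun k =>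
      (measurableSet_le hT measurable_const).inter (hΔ (measurableSet_singleton k))
    have hU : {ω | T ω ≤ ζ} = ⋃ k ∈ (Finset.univ : Finset (Fin K)), {ω | T ω ≤ ζ ∧ Δ ω = k} := by
      ext ω; simp
    have h1 : P.real {ω | T ω ≤ ζ} = ∑ k, F k ζ := by
      rw [hU, measureReal_biUnion_finset _ fun k _ => hm k]
      · exact Finset.sum_congr rfl fun k _ => (hF k ζ).symm
      · intro i _ j _ hij
        refine Set.disjoint_left.2 fun ω h h' => hij (h.2.symm.trans h'.2)
    have h2 : P.real {ω | T ω ≤ ζ}ᶜ = S ζ := by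
      rw [hS, Measure.real]
      congr 2
      ext ω; simp
    rw [← h1, ← h2, measureReal_compl (measurableSet_le hT measurable_const)]
    simp
  rw [hint, hint]
  constructor
  · intro h
    have hn := fun k => gibbs_term (hFpos k) (hp k)
    have hn' := gibbs_term hSpos hs
    have hz : (∑ k, (p k - F k ζ - F k ζ * (Real.log (p k) - Real.log (F k ζ))))
        + (s - S ζ - S ζ * (Real.log s - Real.log (S ζ))) = 0 := by
      simp only [mul_sub, Finset.sum_sub_distrib]
      linarith
    have hnn := Finset.sum_nonneg fun k (_ : k ∈ Finset.univ) => (hn k).1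
    have hz1 : (∑ k, (p k - F k ζ - F k ζ * (Real.log (p k) - Real.log (F k ζ)))) = 0 := by
      linarith [hn'.1]
    refine ⟨fun k => (hn k).2 ?_, hn'.2 (by linarith)⟩
    exact (Finset.sum_eq_zero_iff_of_nonneg fun k _ => (hn k).1).1 hz1 k (Finset.mem_univ k)
  · rintro ⟨h1, h2⟩
    simp only [h1, h2]
end

section
/- (Appendix Lemma: expectation of the generic cause-specific reweighted scoring rule) Fix a time horizon ζ ∈ ℝ with G(ζ) > 0, an event index k ∈ Fin K, a candidate value p ∈ ℝ, and an arbitrary function ℓ : ℝ → Bool → ℝ. Define the pointwise cause-specific score L_{k,ζ}(p)(ω) = 1{T(ω) ≤ ζ ∧ Δ(ω) = k ∧ T(ω) < C(ω)} · ℓ(p, true) / G(T(ω)) + 1{T(ω) > ζ ∧ C(ω) > ζ} · ℓ(p, false) / G(ζ) + 1{T(ω) ≤ ζ ∧ Δ(ω) ≠ k ∧ T(ω) < C(ω)} · ℓ(p, false) / G(T(ω)). Then ∫_Ω L_{k,ζ}(p) dℙ = ℓ(p, true) · F_k(ζ) + ℓ(p, false) · (1 − F_k(ζ)). -/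
open MeasureTheory ProbabilityTheory

/-- The pointwise IPCW-reweighted cause-specific score at horizon `ζ` for event
`k`, built from a binary scoring rule `ℓ` applied to the candidate value `p`. -/
noncomputable def causeScore {Ω : Type*} {K : ℕ}
    (T : Ω → ℝ) (Δ : Ω → Fin K) (C : Ω → ℝ) (G : ℝ → ℝ) (ζ : ℝ) (k : Fin K)
    (ℓ : ℝ → Bool → ℝ) (p : ℝ) (ω : Ω) : ℝ :=
  Set.indicator {ω' | T ω' ≤ ζ ∧ Δ ω' = k ∧ T ω' < C ω'}
      (fun ω' => ℓ p true / G (T ω')) ω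
  + Set.indicator {ω' | ζ < T ω' ∧ ζ < C ω'} (fun _ => ℓ p false / G ζ) ω
  + Set.indicator {ω' | T ω' ≤ ζ ∧ Δ ω' ≠ k ∧ T ω' < C ω'}
      (fun ω' => ℓ p false / G (T ω')) ω

/-- (Appendix Lemma: expectation of the generic cause-specific reweighted
scoring rule) For a horizon `ζ` with `G ζ > 0`, event index `k`, candidate value
`p` and any `ℓ : ℝ → Bool → ℝ`, the expectation of the reweighted score equals
`ℓ p true * F k ζ + ℓ p false * (1 - F k ζ)`. -/
theorem expectation_causeScore
    {Ω : Type*} [MeasurableSpace Ω] (P : Measure Ω) [IsProbabilityMeasure P]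
    {K : ℕ} (hK : 1 ≤ K)
    (T : Ω → ℝ) (Δ : Ω → Fin K) (C : Ω → ℝ)
    (hT : Measurable T) (hΔ : Measurable Δ) (hC : Measurable C)
    (hindep : IndepFun (fun ω => (T ω, Δ ω)) C P)
    (G : ℝ → ℝ) (hG : ∀ t, G t = (P {ω | t < C ω}).toReal)
    (F : Fin K → ℝ → ℝ)
    (hF : ∀ k t, F k t = (P {ω | T ω ≤ t ∧ Δ ω = k}).toReal)
    (ζ : ℝ) (hGζ : 0 < G ζ) (k : Fin K)
    (p : ℝ) (ℓ : ℝ → Bool → ℝ) :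
    ∫ ω, causeScore T Δ C G ζ k ℓ p ω ∂P
      = ℓ p true * F k ζ + ℓ p false * (1 - F k ζ) := by
  classical
  have hGm : Antitone G := by
    intro a b hab
    rw [hG, hG]
    refine ENNReal.toReal_mono (measure_ne_top _ _) (measure_mono ?_)
    intro ω hω
    exact lt_of_le_of_lt hab hω
  have hGmeas : Measurable G := hGm.measurable
  have hXm : Measurable (fun ω => (T ω, Δ ω)) := hT.prodMk hΔ
  have hpos : ∀ t : ℝ, G ζ ≤ G (min t ζ) := fun t => hGm (min_le_right _ _)
  set A : Set (ℝ × Fin K) := {x | x.1 ≤ ζ ∧ x.2 = k} with hA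
  have hAm : MeasurableSet A :=
    (measurableSet_le measurable_fst measurable_const).inter
      (measurable_snd (measurableSet_singleton k))
  set g : ℝ × Fin K → ℝ := fun x => if x ∈ A then ℓ p true else ℓ p false with hg
  have hgm : Measurable g := Measurable.ite hAm measurable_const measurable_const
  set f : (ℝ × Fin K) × ℝ → ℝ := fun z =>
    if min z.1.1 ζ < z.2 then g z.1 / G (min z.1.1 ζ) else 0 with hf
  have hfm : Measurable f := by
    refine Measurable.ite (measurableSet_lt (by fun_prop) (by fun_prop)) ?_ measurable_const
    exact (hgm.comp measurable_fst).div (hGmeas.comp (by fun_prop))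
  have hscore : ∀ ω, causeScore T Δ C G ζ k ℓ p ω = f ((T ω, Δ ω), C ω) := by
    intro ω
    by_cases h1 : T ω ≤ ζ
    · by_cases h2 : Δ ω = k <;> by_cases h3 : T ω < C ω <;>
        simp [causeScore, hf, hg, hA, h1, h2, h3, not_lt.mpr h1] <;> (intro h; exact absurd (h1.trans_lt h) h3)
    · have h1' : ζ < T ω := not_le.mp h1
      by_cases h3 : ζ < C ω <;>
        simp [causeScore, hf, hg, hA, h1, h1', h1'.le, h3]  <;> (intro h; exact absurd (h1'.trans h) h3)
  have hgb : ∀ x, |g x| ≤ |ℓ p true| + |ℓ p false| := by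
    intro x
    simp only [hg]
    split_ifs
    · linarith [abs_nonneg (ℓ p false)]
    · linarith [abs_nonneg (ℓ p true)]
  have hfb : ∀ z, ‖f z‖ ≤ (|ℓ p true| + |ℓ p false|) / G ζ := by
    intro z
    simp only [hf]
    split_ifs
    · rw [Real.norm_eq_abs, abs_div, abs_of_pos (hGζ.trans_le (hpos _))]
      exact div_le_div₀ (by positivity) (hgb _) hGζ (hpos _)
    · rw [norm_zero]
      positivity
  have hprod := (indepFun_iff_map_prod_eq_prod_map_map hXm.aemeasurable hC.aemeasurable).1 hindep
  have : IsProbabilityMeasure (P.map (fun ω => (T ω, Δ ω))) :=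
    Measure.isProbabilityMeasure_map hXm.aemeasurable
  have : IsProbabilityMeasure (P.map C) := Measure.isProbabilityMeasure_map hC.aemeasurable
  have hint : Integrable f ((P.map (fun ω => (T ω, Δ ω))).prod (P.map C)) :=
    Integrable.of_bound hfm.aestronglyMeasurable _ (Filter.Eventually.of_forall hfb)
  have hinner : ∀ x, ∫ c, f (x, c) ∂(P.map C) = g x := by
    intro x
    have e : (fun c => f (x, c))
        = (Set.Ioi (min x.1 ζ)).indicator (fun _ => g x / G (min x.1 ζ)) := by
      funext c
      simp only [hf, Set.indicator, Set.mem_Ioi]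
    have e2 : (P.map C).real (Set.Ioi (min x.1 ζ)) = G (min x.1 ζ) := by
      rw [measureReal_def, Measure.map_apply hC measurableSet_Ioi, hG]
      rfl
    rw [e, integral_indicator_const _ measurableSet_Ioi, e2, smul_eq_mul]
    exact mul_div_cancel₀ _ (hGζ.trans_le (hpos _)).ne'
  have hFA : (P.map (fun ω => (T ω, Δ ω))).real A = F k ζ := by
    rw [measureReal_def, Measure.map_apply hXm hAm, hF]
    rfl
  have hgsum : g = fun x => A.indicator (fun _ => ℓ p true - ℓ p false) x + ℓ p false := by
    funext x
    by_cases h : x ∈ A <;> simp [hg, h]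
  calc ∫ ω, causeScore T Δ C G ζ k ℓ p ω ∂P
      = ∫ ω, f ((T ω, Δ ω), C ω) ∂P := by simp_rw [hscore]
    _ = ∫ z, f z ∂(P.map (fun ω => ((T ω, Δ ω), C ω))) :=
        (integral_map (hXm.prodMk hC).aemeasurable hfm.aestronglyMeasurable).symm
    _ = ∫ x, g x ∂(P.map (fun ω => (T ω, Δ ω))) := by
        rw [hprod, integral_prod _ hint]
        simp_rw [hinner]
    _ = ℓ p true * F k ζ + ℓ p false * (1 - F k ζ) := by
        rw [hgsum, integral_add ((integrable_const _).indicator hAm) (integrable_const _),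
          integral_indicator_const _ hAm, hFA]
        simp
        ring
end

section
/- (Proposition: the reweighted cause-specific scoring rule inherits properness) Fix a time horizon ζ ∈ ℝ with G(ζ) > 0 and an event index k ∈ Fin K. Let ℓ : ℝ → Bool → ℝ be a proper binary scoring rule, i.e., for all q, p ∈ [0, 1]: q · ℓ(p, true) + (1 − q) · ℓ(p, false) ≤ q · ℓ(q, true) + (1 − q) · ℓ(q, false). Define the pointwise cause-specific score L_{k,ζ}(p)(ω) = 1{T(ω) ≤ ζ ∧ Δ(ω) = k ∧ T(ω) < C(ω)} · ℓ(p, true) / G(T(ω)) + 1{T(ω) > ζ ∧ C(ω) > ζ} · ℓ(p, false) / G(ζ) + 1{T(ω) ≤ ζ ∧ Δ(ω) ≠ k ∧ T(ω) < C(ω)} · ℓ(p, false) / G(T(ω)). Then for every p ∈ [0, 1]: ∫_Ω L_{k,ζ}(p) dℙ ≤ ∫_Ω L_{k,ζ}(F_k(ζ)) dℙ. -/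
open MeasureTheory ProbabilityTheory

theorem ipcw_aux_s8 {Ω E : Type*} [MeasurableSpace Ω] [MeasurableSpace E]
    (P : Measure Ω) [IsProbabilityMeasure P]
    (X : Ω → E) (C : Ω → ℝ) (hX : Measurable X) (hC : Measurable C)
    (hindep : IndepFun X C P)
    (G : ℝ → ℝ) (hG : ∀ t, G t = (P {ω | t < C ω}).toReal)
    (ζ : ℝ) (hGζ : 0 < G ζ) (A : Set E) (hA : MeasurableSet A)
    (h : E → ℝ) (hh : Measurable h) (hle : ∀ x ∈ A, h x ≤ ζ) (c : ℝ) :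
    Integrable (Set.indicator {ω | X ω ∈ A ∧ h (X ω) < C ω} (fun ω => c / G (h (X ω)))) P ∧
    ∫ ω, Set.indicator {ω | X ω ∈ A ∧ h (X ω) < C ω} (fun ω => c / G (h (X ω))) ω ∂P
      = c * P.real (X ⁻¹' A) := by
  have hanti : Antitone G := by
    intro a b hab
    rw [hG, hG]
    exact ENNReal.toReal_mono (measure_ne_top _ _)
      (measure_mono fun ω (hω : b < C ω) => lt_of_le_of_lt hab hω)
  have hGm : Measurable G := hanti.measurable
  have hGA : ∀ x ∈ A, G ζ ≤ G (h x) := fun x hx => hanti (hle x hx)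
  set S : Set (E × ℝ) := {z | z.1 ∈ A ∧ h z.1 < z.2} with hS
  have hSm : MeasurableSet S :=
    (measurable_fst hA).inter (measurableSet_lt (hh.comp measurable_fst) measurable_snd)
  set f : E × ℝ → ℝ := S.indicator (fun z => c / G (h z.1)) with hf
  have hfm : Measurable f :=
    (measurable_const.div (hGm.comp (hh.comp measurable_fst))).indicator hSm
  have hfb : ∀ z, ‖f z‖ ≤ |c| / G ζ := by
    intro z
    by_cases hz : z ∈ S
    · rw [hf, Set.indicator_of_mem hz, Real.norm_eq_abs, abs_div,
        abs_of_pos (hGζ.trans_le (hGA _ hz.1))]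
      exact div_le_div_of_nonneg_left (abs_nonneg _) hGζ (hGA _ hz.1)
    · rw [hf, Set.indicator_of_notMem hz, norm_zero]
      positivity
  have hpair : Measurable (fun ω => (X ω, C ω)) := hX.prodMk hC
  have heq : Set.indicator {ω | X ω ∈ A ∧ h (X ω) < C ω} (fun ω => c / G (h (X ω)))
      = fun ω => f (X ω, C ω) := by
    funext ω
    rfl
  have hμ : IsProbabilityMeasure (P.map X) := Measure.isProbabilityMeasure_map hX.aemeasurable
  have hν : IsProbabilityMeasure (P.map C) := Measure.isProbabilityMeasure_map hC.aemeasurable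
  have hmap := (indepFun_iff_map_prod_eq_prod_map_map hX.aemeasurable hC.aemeasurable).1 hindep
  rw [heq]
  refine ⟨Integrable.of_bound (hfm.comp hpair).aestronglyMeasurable _
    (Filter.Eventually.of_forall fun ω => hfb _), ?_⟩
  have h1 : ∫ ω, f (X ω, C ω) ∂P = ∫ z, f z ∂((P.map X).prod (P.map C)) := by
    rw [← hmap, integral_map hpair.aemeasurable hfm.aestronglyMeasurable]
  rw [h1, integral_prod _ (Integrable.of_bound hfm.aestronglyMeasurable _
    (Filter.Eventually.of_forall hfb))]
  have h2 : ∀ x, ∫ y, f (x, y) ∂(P.map C) = A.indicator (fun _ => c) x := by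
    intro x
    by_cases hx : x ∈ A
    · have : (fun y => f (x, y)) = (Set.Ioi (h x)).indicator (fun _ => c / G (h x)) := by
        funext y
        simp [hf, hS, Set.indicator, hx]
      rw [this, integral_indicator_const _ measurableSet_Ioi, Set.indicator_of_mem hx,
        map_measureReal_apply hC measurableSet_Ioi]
      have h3 : P.real (C ⁻¹' Set.Ioi (h x)) = G (h x) := (hG _).symm
      rw [h3, smul_eq_mul]
      exact mul_div_cancel₀ _ (hGζ.trans_le (hGA _ hx)).ne'
    · have : (fun y => f (x, y)) = fun _ => 0 := by
        funext y
        simp [hf, hS, Set.indicator, hx]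
      rw [this, Set.indicator_of_notMem hx, integral_zero]
  simp_rw [h2]
  rw [integral_indicator_const _ hA, map_measureReal_apply hX hA, smul_eq_mul, mul_comm]

/-- (Proposition: the reweighted cause-specific scoring rule inherits
properness) If `ℓ` is a proper binary scoring rule, then for every candidate
`p ∈ [0, 1]` the expected reweighted cause-specific score is at most that of the
oracle `F k ζ`. -/
theorem causeScore_proper
    {Ω : Type*} [MeasurableSpace Ω] (P : Measure Ω) [IsProbabilityMeasure P]
    {K : ℕ} (hK : 1 ≤ K)
    (T : Ω → ℝ) (Δ : Ω → Fin K) (C : Ω → ℝ)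
    (hT : Measurable T) (hΔ : Measurable Δ) (hC : Measurable C)
    (hindep : IndepFun (fun ω => (T ω, Δ ω)) C P)
    (G : ℝ → ℝ) (hG : ∀ t, G t = (P {ω | t < C ω}).toReal)
    (F : Fin K → ℝ → ℝ)
    (hF : ∀ k t, F k t = (P {ω | T ω ≤ t ∧ Δ ω = k}).toReal)
    (ζ : ℝ) (hGζ : 0 < G ζ) (k : Fin K)
    (ℓ : ℝ → Bool → ℝ)
    (hproper : ∀ q p : ℝ, q ∈ Set.Icc (0:ℝ) 1 → p ∈ Set.Icc (0:ℝ) 1 →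
      q * ℓ p true + (1 - q) * ℓ p false ≤ q * ℓ q true + (1 - q) * ℓ q false)
    (p : ℝ) (hp : p ∈ Set.Icc (0:ℝ) 1) :
    ∫ ω, causeScore T Δ C G ζ k ℓ p ω ∂P
      ≤ ∫ ω, causeScore T Δ C G ζ k ℓ (F k ζ) ω ∂P := by
  have hX : Measurable (fun ω => (T ω, Δ ω)) := hT.prodMk hΔ
  have hT1 : MeasurableSet {x : ℝ × Fin K | x.1 ≤ ζ} := measurableSet_le measurable_fst measurable_const
  have hT2 : MeasurableSet {x : ℝ × Fin K | ζ < x.1} := measurableSet_lt measurable_const measurable_fst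
  have hD : MeasurableSet {x : ℝ × Fin K | x.2 = k} := measurable_snd (measurableSet_singleton k)
  have hA1 : MeasurableSet {x : ℝ × Fin K | x.1 ≤ ζ ∧ x.2 = k} := hT1.inter hD
  have hA3 : MeasurableSet {x : ℝ × Fin K | x.1 ≤ ζ ∧ x.2 ≠ k} := hT1.inter hD.compl
  have key : ∀ r, ∫ ω, causeScore T Δ C G ζ k ℓ r ω ∂P
      = F k ζ * ℓ r true + (1 - F k ζ) * ℓ r false := by
    intro r
    obtain ⟨i1, e1⟩ := ipcw_aux_s8 P _ C hX hC hindep G hG ζ hGζ _ hA1 Prod.fst measurable_fst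
      (fun x hx => hx.1) (ℓ r true)
    obtain ⟨i2, e2⟩ := ipcw_aux_s8 P _ C hX hC hindep G hG ζ hGζ _ hT2 (fun _ => ζ) measurable_const
      (fun x hx => le_rfl) (ℓ r false)
    obtain ⟨i3, e3⟩ := ipcw_aux_s8 P _ C hX hC hindep G hG ζ hGζ _ hA3 Prod.fst measurable_fst
      (fun x hx => hx.1) (ℓ r false)
    have hsum := integral_add (i1.add i2) i3
    have hsum' := integral_add i1 i2
    simp only [Pi.add_apply] at hsum
    rw [hsum', e1, e2, e3] at hsum
    have e : ∫ ω, causeScore T Δ C G ζ k ℓ r ω ∂P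
        = ℓ r true * P.real ((fun ω => (T ω, Δ ω)) ⁻¹' {x : ℝ × Fin K | x.1 ≤ ζ ∧ x.2 = k})
        + ℓ r false * P.real ((fun ω => (T ω, Δ ω)) ⁻¹' {x : ℝ × Fin K | ζ < x.1})
        + ℓ r false * P.real ((fun ω => (T ω, Δ ω)) ⁻¹' {x : ℝ × Fin K | x.1 ≤ ζ ∧ x.2 ≠ k}) := by
      refine Eq.trans (integral_congr_ae (Filter.Eventually.of_forall fun ω => ?_)) hsum
      simp only [causeScore, Set.indicator, Set.mem_setOf_eq, and_assoc]
    rw [e]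
    have hF1 : P.real ((fun ω => (T ω, Δ ω)) ⁻¹' {x : ℝ × Fin K | x.1 ≤ ζ ∧ x.2 = k}) = F k ζ :=
      (hF k ζ).symm
    have hu : P.real ((fun ω => (T ω, Δ ω)) ⁻¹' {x : ℝ × Fin K | ζ < x.1})
        + P.real ((fun ω => (T ω, Δ ω)) ⁻¹' {x : ℝ × Fin K | x.1 ≤ ζ ∧ x.2 ≠ k}) = 1 - F k ζ := by
      rw [← hF1, ← probReal_compl_eq_one_sub (hX hA1), ← measureReal_union ?_ (hX hA3)]
      · congr 1
        ext ω
        simp only [Set.mem_union, Set.mem_preimage, Set.mem_setOf_eq, Set.mem_compl_iff]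
        rw [← not_le]
        tauto
      · rw [Set.disjoint_left]
        intro ω h1 h2
        exact absurd h2.1 (not_le.2 h1)
    rw [hF1, ← hu]
    ring
  rw [key, key]
  refine hproper _ _ ?_ hp
  rw [hF]
  exact ⟨ENNReal.toReal_nonneg, measureReal_le_one⟩
end

section
/- (Proposition, strict version: the reweighted cause-specific scoring rule inherits strict properness) Fix a time horizon ζ ∈ ℝ with G(ζ) > 0 and an event index k ∈ Fin K. Let ℓ : ℝ → Bool → ℝ be a strictly proper binary scoring rule, i.e., for all q, p ∈ [0, 1]: q · ℓ(p, true) + (1 − q) · ℓ(p, false) ≤ q · ℓ(q, true) + (1 − q) · ℓ(q, false), with equality if and only if p = q. Define L_{k,ζ}(p)(ω) = 1{T(ω) ≤ ζ ∧ Δ(ω) = k ∧ T(ω) < C(ω)} · ℓ(p, true) / G(T(ω)) + 1{T(ω) > ζ ∧ C(ω) > ζ} · ℓ(p, false) / G(ζ) + 1{T(ω) ≤ ζ ∧ Δ(ω) ≠ k ∧ T(ω) < C(ω)} · ℓ(p, false) / G(T(ω)). Then for every p ∈ [0, 1], ∫_Ω L_{k,ζ}(p) dℙ = ∫_Ω L_{k,ζ}(F_k(ζ))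 dℙ if and only if p = F_k(ζ). -/
open MeasureTheory ProbabilityTheory

lemma causeScore_integral_aux
    {Ω : Type*} [MeasurableSpace Ω] (P : Measure Ω) [IsProbabilityMeasure P]
    {K : ℕ}
    (T : Ω → ℝ) (Δ : Ω → Fin K) (C : Ω → ℝ)
    (hT : Measurable T) (hΔ : Measurable Δ) (hC : Measurable C)
    (hindep : IndepFun (fun ω => (T ω, Δ ω)) C P)
    (G : ℝ → ℝ) (hG : ∀ t, G t = (P {ω | t < C ω}).toReal)
    (ζ : ℝ) (hGζ : 0 < G ζ) (k : Fin K) (ℓ : ℝ → Bool → ℝ) (p : ℝ) :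
    ∫ ω, causeScore T Δ C G ζ k ℓ p ω ∂P
      = (P {ω | T ω ≤ ζ ∧ Δ ω = k}).toReal * ℓ p true
        + (1 - (P {ω | T ω ≤ ζ ∧ Δ ω = k}).toReal) * ℓ p false := by
  classical
  have hanti : Antitone G := by
    intro s t hst
    rw [hG, hG]
    exact ENNReal.toReal_mono (measure_ne_top _ _)
      (measure_mono (fun ω (h : t < C ω) => lt_of_le_of_lt hst h))
  have hGm : Measurable G := hanti.measurable
  let A : Set (ℝ × Fin K) := {x | x.1 ≤ ζ ∧ x.2 = k}
  have hA : MeasurableSet A :=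
    (measurableSet_le measurable_fst measurable_const).inter
      (measurable_snd (measurableSet_singleton k))
  let g : ℝ × Fin K → ℝ := fun x => if x ∈ A then ℓ p true else ℓ p false
  have hg : Measurable g := Measurable.ite hA measurable_const measurable_const
  let f : (ℝ × Fin K) × ℝ → ℝ :=
    Set.indicator {y | min y.1.1 ζ < y.2} (fun y => g y.1 / G (min y.1.1 ζ))
  have hS : MeasurableSet {y : (ℝ × Fin K) × ℝ | min y.1.1 ζ < y.2} :=
    measurableSet_lt (by fun_prop) (by fun_prop)
  have hf : Measurable f := by
    refine Measurable.indicator ?_ hS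
    exact (hg.comp measurable_fst).div (hGm.comp (by fun_prop))
  have hX : Measurable (fun ω => (T ω, Δ ω)) := hT.prodMk hΔ
  have hmap := (indepFun_iff_map_prod_eq_prod_map_map hX.aemeasurable hC.aemeasurable).1 hindep
  have e1 : ∀ ω, causeScore T Δ C G ζ k ℓ p ω = f ((T ω, Δ ω), C ω) := by
    intro ω
    simp only [causeScore, f, g, A, Set.indicator, Set.mem_setOf_eq]
    rcases le_or_gt (T ω) ζ with h | h
    · have h' : ¬ ζ < T ω := not_lt.2 h
      by_cases hk : Δ ω = k <;> by_cases hc : T ω < C ω <;> simp [h, h', hk, hc, min_eq_left h]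
    · have h' : ¬ T ω ≤ ζ := not_le.2 h
      by_cases hc : ζ < C ω <;> simp [h, h', hc, min_eq_right h.le]
  haveI : IsProbabilityMeasure (P.map (fun ω => (T ω, Δ ω))) :=
    Measure.isProbabilityMeasure_map hX.aemeasurable
  haveI : IsProbabilityMeasure (P.map C) := Measure.isProbabilityMeasure_map hC.aemeasurable
  have hpos : ∀ t, 0 < G (min t ζ) := fun t => hGζ.trans_le (hanti (min_le_right _ _))
  have hint : Integrable f ((P.map (fun ω => (T ω, Δ ω))).prod (P.map C)) := by
    refine Integrable.of_bound hf.aestronglyMeasurable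
      ((|ℓ p true| + |ℓ p false|) / G ζ) (Filter.Eventually.of_forall fun y => ?_)
    refine (norm_indicator_le_norm_self _ _).trans ?_
    rw [norm_div, Real.norm_eq_abs, Real.norm_eq_abs, abs_of_pos (hpos _)]
    refine div_le_div₀ (by positivity) ?_ hGζ (hanti (min_le_right _ _))
    simp only [g]
    split_ifs
    · linarith [abs_nonneg (ℓ p false)]
    · linarith [abs_nonneg (ℓ p true)]
  have hinner : ∀ x : ℝ × Fin K, ∫ c, f (x, c) ∂(P.map C) = g x := by
    intro x
    have : (fun c => f (x, c)) =
        Set.indicator (Set.Ioi (min x.1 ζ)) (fun _ => g x / G (min x.1 ζ)) := by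
      funext c
      simp [f, Set.indicator]
    rw [this, integral_indicator_const _ measurableSet_Ioi, measureReal_def,
      Measure.map_apply hC measurableSet_Ioi]
    have h2 : (P (C ⁻¹' Set.Ioi (min x.1 ζ))).toReal = G (min x.1 ζ) := (hG _).symm
    rw [h2, smul_eq_mul, mul_div_cancel₀ _ (hpos _).ne']
  simp_rw [e1]
  rw [← integral_map (φ := fun ω => ((T ω, Δ ω), C ω)) (hX.prodMk hC).aemeasurable
    hf.aestronglyMeasurable, hmap, integral_prod _ hint]
  simp_rw [hinner]
  have hg' : g = fun x => A.indicator (fun _ => ℓ p true - ℓ p false) x + ℓ p false := by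
    funext x
    by_cases hx : x ∈ A <;> simp [g, hx]
  rw [hg', integral_add ((integrable_const _).indicator hA) (integrable_const _),
    integral_indicator_const _ hA, measureReal_def, Measure.map_apply hX hA]
  have h3 : (fun ω => (T ω, Δ ω)) ⁻¹' A = {ω | T ω ≤ ζ ∧ Δ ω = k} := rfl
  rw [h3]
  simp
  ring

/-- (Proposition, strict version: the reweighted cause-specific scoring rule
inherits strict properness) If `ℓ` is a strictly proper binary scoring rule,
then for every candidate `p ∈ [0, 1]` the expected reweighted cause-specific
score equals that of the oracle `F k ζ` if and only if `p = F k ζ`. -/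
theorem causeScore_strictly_proper
    {Ω : Type*} [MeasurableSpace Ω] (P : Measure Ω) [IsProbabilityMeasure P]
    {K : ℕ} (hK : 1 ≤ K)
    (T : Ω → ℝ) (Δ : Ω → Fin K) (C : Ω → ℝ)
    (hT : Measurable T) (hΔ : Measurable Δ) (hC : Measurable C)
    (hindep : IndepFun (fun ω => (T ω, Δ ω)) C P)
    (G : ℝ → ℝ) (hG : ∀ t, G t = (P {ω | t < C ω}).toReal)
    (F : Fin K → ℝ → ℝ)
    (hF : ∀ k t, F k t = (P {ω | T ω ≤ t ∧ Δ ω = k}).toReal)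
    (ζ : ℝ) (hGζ : 0 < G ζ) (k : Fin K)
    (ℓ : ℝ → Bool → ℝ)
    (hproper : ∀ q p : ℝ, q ∈ Set.Icc (0:ℝ) 1 → p ∈ Set.Icc (0:ℝ) 1 →
      q * ℓ p true + (1 - q) * ℓ p false ≤ q * ℓ q true + (1 - q) * ℓ q false)
    (hstrict : ∀ q p : ℝ, q ∈ Set.Icc (0:ℝ) 1 → p ∈ Set.Icc (0:ℝ) 1 →
      (q * ℓ p true + (1 - q) * ℓ p false
        = q * ℓ q true + (1 - q) * ℓ q false ↔ p = q))
    (p : ℝ) (hp : p ∈ Set.Icc (0:ℝ) 1) :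
    ∫ ω, causeScore T Δ C G ζ k ℓ p ω ∂P
        = ∫ ω, causeScore T Δ C G ζ k ℓ (F k ζ) ω ∂P
      ↔ p = F k ζ := by
  have hFm : F k ζ ∈ Set.Icc (0:ℝ) 1 := by
    rw [hF]
    exact ⟨ENNReal.toReal_nonneg, measureReal_le_one⟩
  rw [causeScore_integral_aux P T Δ C hT hΔ hC hindep G hG ζ hGζ k ℓ p,
    causeScore_integral_aux P T Δ C hT hΔ hC hindep G hG ζ hGζ k ℓ (F k ζ), ← hF k ζ]
  exact hstrict _ _ hFm hp
end

section
/- (Expected value of the censoring-adjusted Brier score for the k-th competing event) Fix a time horizon ζ ∈ ℝ with G(ζ) > 0, an event index k ∈ Fin K, and a candidate value p ∈ ℝ. Define the pointwise censoring-adjusted Brier score BS_{k,ζ}(p)(ω) = 1{T(ω) ≤ ζ ∧ Δ(ω) = k ∧ T(ω) < C(ω)} · (1 − p)² / G(T(ω)) + 1{T(ω) > ζ ∧ C(ω) > ζ} · p² / G(ζ) + 1{T(ω) ≤ ζ ∧ Δ(ω) ≠ k ∧ T(ω) < C(ω)} · p² / G(T(ω)). Then ∫_Ω BS_{k,ζ}(p)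 dℙ = (1 − p)² · F_k(ζ) + p² · (1 − F_k(ζ)). -/
open MeasureTheory ProbabilityTheory

/-- The pointwise censoring-adjusted Brier score for the `k`-th competing event
at horizon `ζ`, evaluated at candidate probability `p`. -/
noncomputable def brierScore {Ω : Type*} {K : ℕ}
    (T : Ω → ℝ) (Δ : Ω → Fin K) (C : Ω → ℝ) (G : ℝ → ℝ) (ζ : ℝ) (k : Fin K)
    (p : ℝ) (ω : Ω) : ℝ :=
  Set.indicator {ω' | T ω' ≤ ζ ∧ Δ ω' = k ∧ T ω' < C ω'}
      (fun ω' => (1 - p) ^ 2 / G (T ω')) ω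
  + Set.indicator {ω' | ζ < T ω' ∧ ζ < C ω'} (fun _ => p ^ 2 / G ζ) ω
  + Set.indicator {ω' | T ω' ≤ ζ ∧ Δ ω' ≠ k ∧ T ω' < C ω'}
      (fun ω' => p ^ 2 / G (T ω')) ω

theorem brier_aux
    {Ω : Type*} [MeasurableSpace Ω] (P : Measure Ω) [IsProbabilityMeasure P]
    {E : Type*} [MeasurableSpace E] (X : Ω → E) (C : Ω → ℝ)
    (hX : Measurable X) (hC : Measurable C) (hindep : IndepFun X C P)
    (G : ℝ → ℝ) (hG : ∀ t, G t = (P {ω | t < C ω}).toReal)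
    (ζ : ℝ) (hGζ : 0 < G ζ) (g : E → ℝ) (hg : Measurable g) (hgζ : ∀ x, g x ≤ ζ)
    (S : Set E) (hS : MeasurableSet S) (c : ℝ) :
    Integrable (fun ω => Set.indicator {ω' | X ω' ∈ S ∧ g (X ω') < C ω'}
      (fun ω' => c / G (g (X ω'))) ω) P ∧
    ∫ ω, Set.indicator {ω' | X ω' ∈ S ∧ g (X ω') < C ω'}
      (fun ω' => c / G (g (X ω'))) ω ∂P = c * (P {ω | X ω ∈ S}).toReal := by
  have hanti : Antitone G := by
    intro a b hab
    rw [hG, hG]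
    apply ENNReal.toReal_mono (measure_ne_top _ _)
    apply measure_mono
    intro ω hω
    exact lt_of_le_of_lt hab hω
  have hGm : Measurable G := hanti.measurable
  have hpos : ∀ x, 0 < G (g x) := fun x => lt_of_lt_of_le hGζ (hanti (hgζ x))
  have hmA : MeasurableSet {z : E × ℝ | z.1 ∈ S ∧ g z.1 < z.2} :=
    (measurable_fst hS).inter (measurableSet_lt (hg.comp measurable_fst) measurable_snd)
  let f : E × ℝ → ℝ := Set.indicator {z : E × ℝ | z.1 ∈ S ∧ g z.1 < z.2}
    (fun z => c / G (g z.1))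
  have hfm : Measurable f :=
    (measurable_const.div (hGm.comp (hg.comp measurable_fst))).indicator hmA
  have hfb : ∀ z, ‖f z‖ ≤ |c| / G ζ := by
    intro z
    refine (norm_indicator_le_norm_self _ _).trans ?_
    rw [Real.norm_eq_abs, abs_div, abs_of_pos (hpos _)]
    exact div_le_div_of_nonneg_left (abs_nonneg _) hGζ (hanti (hgζ _))
  have hXC : Measurable (fun ω => (X ω, C ω)) := hX.prodMk hC
  have hpX : IsProbabilityMeasure (P.map X) := Measure.isProbabilityMeasure_map hX.aemeasurable
  have hpC : IsProbabilityMeasure (P.map C) := Measure.isProbabilityMeasure_map hC.aemeasurable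
  have hmap := (indepFun_iff_map_prod_eq_prod_map_map hX.aemeasurable hC.aemeasurable).1 hindep
  have heq : (fun ω => Set.indicator {ω' | X ω' ∈ S ∧ g (X ω') < C ω'}
      (fun ω' => c / G (g (X ω'))) ω) = fun ω => f (X ω, C ω) := by
    funext ω
    simp [f, Set.indicator]
  rw [heq]
  refine ⟨Integrable.of_bound (hfm.comp hXC).aestronglyMeasurable (|c| / G ζ)
    (Filter.Eventually.of_forall fun ω => hfb _), ?_⟩
  rw [← integral_map (f := f) hXC.aemeasurable hfm.aestronglyMeasurable, hmap,
    integral_prod f (Integrable.of_bound hfm.aestronglyMeasurable (|c| / G ζ)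
    (Filter.Eventually.of_forall hfb))]
  have hin : ∀ x, ∫ y, f (x, y) ∂(P.map C) = S.indicator (fun _ => c) x := by
    intro x
    by_cases hx : x ∈ S
    · have h1 : (fun y => f (x, y)) = (Set.Ioi (g x)).indicator (fun _ => c / G (g x)) := by
        funext y
        simp [f, Set.indicator, hx]
      have h2 : (P.map C).real (Set.Ioi (g x)) = G (g x) := by
        rw [hG, Measure.real, Measure.map_apply hC measurableSet_Ioi]
        rfl
      rw [h1, integral_indicator_const _ measurableSet_Ioi, h2, Set.indicator_of_mem hx,
        smul_eq_mul, mul_div_cancel₀ _ (hpos x).ne']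
    · have h1 : (fun y => f (x, y)) = fun _ => 0 := by
        funext y
        simp [f, Set.indicator, hx]
      rw [h1, Set.indicator_of_notMem hx]
      simp
  simp_rw [hin]
  rw [integral_indicator_const _ hS, Measure.real, Measure.map_apply hX hS, smul_eq_mul, mul_comm]
  rfl

/-- (Expected value of the censoring-adjusted Brier score for the k-th
competing event) For a horizon `ζ` with `G ζ > 0`, the expected
censoring-adjusted Brier score of the candidate `p` equals
`(1 - p)² * F k ζ + p² * (1 - F k ζ)`. -/
theorem expectation_brierScore
    {Ω : Type*} [MeasurableSpace Ω] (P : Measure Ω) [IsProbabilityMeasure P]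
    {K : ℕ} (hK : 1 ≤ K)
    (T : Ω → ℝ) (Δ : Ω → Fin K) (C : Ω → ℝ)
    (hT : Measurable T) (hΔ : Measurable Δ) (hC : Measurable C)
    (hindep : IndepFun (fun ω => (T ω, Δ ω)) C P)
    (G : ℝ → ℝ) (hG : ∀ t, G t = (P {ω | t < C ω}).toReal)
    (F : Fin K → ℝ → ℝ)
    (hF : ∀ k t, F k t = (P {ω | T ω ≤ t ∧ Δ ω = k}).toReal)
    (ζ : ℝ) (hGζ : 0 < G ζ) (k : Fin K) (p : ℝ) :
    ∫ ω, brierScore T Δ C G ζ k p ω ∂P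
      = (1 - p) ^ 2 * F k ζ + p ^ 2 * (1 - F k ζ) := by
  have hX : Measurable (fun ω => (T ω, Δ ω)) := hT.prodMk hΔ
  have hg : Measurable (fun x : ℝ × Fin K => min x.1 ζ) := measurable_fst.min measurable_const
  have key := fun S hS c => brier_aux P (fun ω => (T ω, Δ ω)) C hX hC hindep G hG ζ hGζ
    (fun x => min x.1 ζ) hg (fun x => min_le_right _ _) S hS c
  have mle : MeasurableSet {x : ℝ × Fin K | x.1 ≤ ζ} :=
    measurableSet_le measurable_fst measurable_const
  have mk : MeasurableSet {x : ℝ × Fin K | x.2 = k} :=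
    measurable_snd (measurableSet_singleton k)
  obtain ⟨i1, e1⟩ := key _ (mle.inter mk) ((1 - p) ^ 2)
  obtain ⟨i2, e2⟩ := key _ mle.compl (p ^ 2)
  obtain ⟨i3, e3⟩ := key _ (mle.inter mk.compl) (p ^ 2)
  have r1 : ∀ ω, Set.indicator {ω' | T ω' ≤ ζ ∧ Δ ω' = k ∧ T ω' < C ω'}
      (fun ω' => (1 - p) ^ 2 / G (T ω')) ω = _ := fun ω => by
    refine Eq.trans ?_ (Eq.refl (Set.indicator {ω' | (T ω', Δ ω') ∈
      {x : ℝ × Fin K | x.1 ≤ ζ} ∩ {x | x.2 = k} ∧ min (T ω') ζ < C ω'}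
      (fun ω' => (1 - p) ^ 2 / G (min (T ω') ζ)) ω))
    by_cases h : T ω ≤ ζ
    · have hz : (T ω < C ω ∨ ζ < C ω) ↔ T ω < C ω :=
        ⟨fun h2 => h2.elim id (fun h3 => lt_of_le_of_lt h h3), Or.inl⟩
      simp [Set.indicator, h, and_assoc, hz]
    · simp [Set.indicator, h]
  have r2 : ∀ ω, Set.indicator {ω' | ζ < T ω' ∧ ζ < C ω'} (fun _ => p ^ 2 / G ζ) ω = _ :=
    fun ω => by
    refine Eq.trans ?_ (Eq.refl (Set.indicator {ω' | (T ω', Δ ω') ∈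
      {x : ℝ × Fin K | x.1 ≤ ζ}ᶜ ∧ min (T ω') ζ < C ω'}
      (fun ω' => p ^ 2 / G (min (T ω') ζ)) ω))
    by_cases h : T ω ≤ ζ
    · simp [Set.indicator, h, not_lt.2 h]
    · have h' := not_le.1 h
      simp [Set.indicator, h', min_eq_right h'.le]
      try grind
  have r3 : ∀ ω, Set.indicator {ω' | T ω' ≤ ζ ∧ Δ ω' ≠ k ∧ T ω' < C ω'}
      (fun ω' => p ^ 2 / G (T ω')) ω = _ := fun ω => by
    refine Eq.trans ?_ (Eq.refl (Set.indicator {ω' | (T ω', Δ ω') ∈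
      {x : ℝ × Fin K | x.1 ≤ ζ} ∩ {x | x.2 = k}ᶜ ∧ min (T ω') ζ < C ω'}
      (fun ω' => p ^ 2 / G (min (T ω') ζ)) ω))
    by_cases h : T ω ≤ ζ
    · have hz : (T ω < C ω ∨ ζ < C ω) ↔ T ω < C ω :=
        ⟨fun h2 => h2.elim id (fun h3 => lt_of_le_of_lt h h3), Or.inl⟩
      simp [Set.indicator, h, and_assoc, hz]
    · simp [Set.indicator, h]
  have hsum : P.real {ω | (T ω, Δ ω) ∈ {x : ℝ × Fin K | x.1 ≤ ζ} ∩ {x | x.2 = k}}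
      + P.real {ω | (T ω, Δ ω) ∈ {x : ℝ × Fin K | x.1 ≤ ζ} ∩ {x | x.2 = k}ᶜ}
      + P.real {ω | (T ω, Δ ω) ∈ {x : ℝ × Fin K | x.1 ≤ ζ}ᶜ} = 1 := by
    have a1 := measureReal_inter_add_sdiff (μ := P)
      (s := (fun ω => (T ω, Δ ω)) ⁻¹' {x : ℝ × Fin K | x.1 ≤ ζ}) (hX mk)
    have a2 := probReal_add_probReal_compl (μ := P) (hX mle)
    rw [← a2, ← a1]
    rfl
  have hFk : F k ζ = P.real {ω | (T ω, Δ ω) ∈ {x : ℝ × Fin K | x.1 ≤ ζ} ∩ {x | x.2 = k}} :=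
    hF k ζ
  simp_rw [brierScore, r1, r2, r3]
  refine (integral_add (i1.add i2) i3).trans ?_
  rw [e3]
  refine (congrArg (· + _) (integral_add i1 i2)).trans ?_
  rw [e1, e2, hFk]
  simp only [Measure.real] at hsum ⊢
  linear_combination p ^ 2 * hsum
end

section
/- (Strict properness of the censoring-adjusted Brier score) Fix a time horizon ζ ∈ ℝ with G(ζ) > 0 and an event index k ∈ Fin K. With BS_{k,ζ}(p)(ω) = 1{T(ω) ≤ ζ ∧ Δ(ω) = k ∧ T(ω) < C(ω)} · (1 − p)² / G(T(ω)) + 1{T(ω) > ζ ∧ C(ω) > ζ} · p² / G(ζ) + 1{T(ω) ≤ ζ ∧ Δ(ω) ≠ k ∧ T(ω) < C(ω)} · p² / G(T(ω)), for every p ∈ ℝ the excess expected Brier score over the oracle is exactly the squared error of the candidate: ∫_Ω BS_{k,ζ}(p) dℙ − ∫_Ω BS_{k,ζ}(F_k(ζ)) dℙ = (p − F_k(ζ))². In particular ∫_Ω BS_{k,ζ}(p) dℙ ≥ ∫_Ω BS_{k,ζ}(F_k(ζ)) dℙ with equality if and only if p = F_k(ζ). -/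
open MeasureTheory ProbabilityTheory

/-- The expected score is a quadratic polynomial in the candidate. -/
theorem integral_brierScore_aux
    {Ω : Type*} [MeasurableSpace Ω] (P : Measure Ω) [IsProbabilityMeasure P]
    {K : ℕ}
    (T : Ω → ℝ) (Δ : Ω → Fin K) (C : Ω → ℝ)
    (hT : Measurable T) (hΔ : Measurable Δ) (hC : Measurable C)
    (hindep : IndepFun (fun ω => (T ω, Δ ω)) C P)
    (G : ℝ → ℝ) (hG : ∀ t, G t = (P {ω | t < C ω}).toReal)
    (F : Fin K → ℝ → ℝ)
    (hF : ∀ k t, F k t = (P {ω | T ω ≤ t ∧ Δ ω = k}).toReal)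
    (ζ : ℝ) (hGζ : 0 < G ζ) (k : Fin K) (p : ℝ) :
    (∫ ω, brierScore T Δ C G ζ k p ω ∂P) = p ^ 2 + (1 - 2 * p) * F k ζ := by
  classical
  have hanti : Antitone G := by
    intro a b hab
    rw [hG, hG]
    exact ENNReal.toReal_mono (measure_ne_top _ _)
      (measure_mono fun ω (h : b < C ω) => lt_of_le_of_lt hab h)
  have hGm : Measurable G := hanti.measurable
  have hX : Measurable (fun ω => (T ω, Δ ω)) := hT.prodMk hΔ
  let A : Set (ℝ × Fin K) := {x | x.1 ≤ ζ ∧ x.2 = k}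
  have hA : MeasurableSet A :=
    (measurableSet_le measurable_fst measurable_const).inter
      (measurable_snd (measurableSet_singleton k))
  let φ : ℝ × Fin K → ℝ := fun x => p ^ 2 + A.indicator (fun _ => 1 - 2 * p) x
  have hφ : Measurable φ := measurable_const.add (measurable_const.indicator hA)
  let B : Set ((ℝ × Fin K) × ℝ) := {z | min z.1.1 ζ < z.2}
  have hB : MeasurableSet B :=
    measurableSet_lt ((measurable_fst.comp measurable_fst).min measurable_const) measurable_snd
  let f : (ℝ × Fin K) × ℝ → ℝ :=
    B.indicator (fun z => φ z.1 / G (min z.1.1 ζ))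
  have hf : Measurable f :=
    ((hφ.comp measurable_fst).div
      (hGm.comp ((measurable_fst.comp measurable_fst).min measurable_const))).indicator hB
  have hmin : ∀ t, G ζ ≤ G (min t ζ) := fun t => hanti (min_le_right _ _)
  have hpt : ∀ ω, brierScore T Δ C G ζ k p ω = f ((T ω, Δ ω), C ω) := by
    intro ω
    simp only [brierScore, f, B, φ, A, Set.indicator_apply, Set.mem_setOf_eq]
    rcases le_or_gt (T ω) ζ with h | h
    · by_cases hk : Δ ω = k <;> by_cases hc : T ω < C ω <;>
        simp [h, hk, hc, not_lt.mpr h]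
      ring
    · by_cases hc : ζ < C ω <;>
        simp [h, hc, not_le.mpr h, min_eq_right h.le]
  have hmap := (indepFun_iff_map_prod_eq_prod_map_map hX.aemeasurable hC.aemeasurable).1 hindep
  haveI : IsProbabilityMeasure (P.map C) := Measure.isProbabilityMeasure_map hC.aemeasurable
  haveI : IsProbabilityMeasure (P.map fun ω => (T ω, Δ ω)) :=
    Measure.isProbabilityMeasure_map hX.aemeasurable
  have hfi : Integrable f ((P.map fun ω => (T ω, Δ ω)).prod (P.map C)) := by
    refine Integrable.of_bound hf.aestronglyMeasurable ((p ^ 2 + |1 - 2 * p|) / G ζ)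
      (Filter.Eventually.of_forall fun z => ?_)
    have h1 : ‖f z‖ ≤ ‖φ z.1 / G (min z.1.1 ζ)‖ := norm_indicator_le_norm_self _ _
    refine h1.trans ?_
    rw [norm_div, Real.norm_eq_abs, Real.norm_eq_abs, abs_of_pos (hGζ.trans_le (hmin _))]
    have h2 : |φ z.1| ≤ p ^ 2 + |1 - 2 * p| := by
      refine (abs_add_le _ _).trans ?_
      rw [abs_of_nonneg (sq_nonneg p)]
      exact add_le_add le_rfl (norm_indicator_le_norm_self (fun _ => 1 - 2 * p) _)
    exact div_le_div₀ (by positivity) h2 hGζ (hmin _)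
  have hinner : ∀ x : ℝ × Fin K, ∫ c, f (x, c) ∂(P.map C) = φ x := by
    intro x
    have : (fun c => f (x, c)) =
        (Set.Ioi (min x.1 ζ)).indicator (fun _ => φ x / G (min x.1 ζ)) := by
      ext c
      simp [f, B, Set.indicator_apply]
    rw [this, integral_indicator_const _ measurableSet_Ioi, measureReal_def,
      Measure.map_apply hC measurableSet_Ioi]
    have h3 : (P (C ⁻¹' Set.Ioi (min x.1 ζ))).toReal = G (min x.1 ζ) := (hG _).symm
    rw [h3, smul_eq_mul, mul_div_cancel₀ _ (hGζ.trans_le (hmin _)).ne']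
  calc (∫ ω, brierScore T Δ C G ζ k p ω ∂P)
      = ∫ ω, f ((T ω, Δ ω), C ω) ∂P := by simp_rw [hpt]
    _ = ∫ z, f z ∂(P.map fun ω => ((T ω, Δ ω), C ω)) :=
        (integral_map (hX.prodMk hC).aemeasurable hf.aestronglyMeasurable).symm
    _ = ∫ x, φ x ∂(P.map fun ω => (T ω, Δ ω)) := by
        rw [hmap, integral_prod _ hfi]; simp_rw [hinner]
    _ = p ^ 2 + (1 - 2 * p) * F k ζ := by
        have h4 : ((P.map fun ω => (T ω, Δ ω)) A).toReal = F k ζ := by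
          rw [Measure.map_apply hX hA, hF]; rfl
        rw [integral_add (integrable_const _) ((integrable_const _).indicator hA),
          integral_indicator_const _ hA, measureReal_def, h4]
        simp [mul_comm]

/-- (Strict properness of the censoring-adjusted Brier score) The excess
expected Brier score of any candidate `p` over the oracle `F k ζ` is exactly
the squared error `(p - F k ζ)²`; in particular the oracle minimizes the
expected score, uniquely. -/
theorem brierScore_strictly_proper
    {Ω : Type*} [MeasurableSpace Ω] (P : Measure Ω) [IsProbabilityMeasure P]
    {K : ℕ} (hK : 1 ≤ K)
    (T : Ω → ℝ) (Δ : Ω → Fin K) (C : Ω → ℝ)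
    (hT : Measurable T) (hΔ : Measurable Δ) (hC : Measurable C)
    (hindep : IndepFun (fun ω => (T ω, Δ ω)) C P)
    (G : ℝ → ℝ) (hG : ∀ t, G t = (P {ω | t < C ω}).toReal)
    (F : Fin K → ℝ → ℝ)
    (hF : ∀ k t, F k t = (P {ω | T ω ≤ t ∧ Δ ω = k}).toReal)
    (ζ : ℝ) (hGζ : 0 < G ζ) (k : Fin K) (p : ℝ) :
    (∫ ω, brierScore T Δ C G ζ k p ω ∂P)
        - (∫ ω, brierScore T Δ C G ζ k (F k ζ) ω ∂P)
      = (p - F k ζ) ^ 2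
    ∧ (∫ ω, brierScore T Δ C G ζ k (F k ζ) ω ∂P)
        ≤ (∫ ω, brierScore T Δ C G ζ k p ω ∂P)
    ∧ ((∫ ω, brierScore T Δ C G ζ k p ω ∂P)
          = (∫ ω, brierScore T Δ C G ζ k (F k ζ) ω ∂P)
        ↔ p = F k ζ) := by
  have key := integral_brierScore_aux P T Δ C hT hΔ hC hindep G hG F hF ζ hGζ k
  rw [key p, key (F k ζ)]
  refine ⟨by ring, by nlinarith [sq_nonneg (p - F k ζ)], fun h => ?_, fun h => by rw [h]⟩
  have h0 : (p - F k ζ) ^ 2 = 0 := by linarith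
  exact sub_eq_zero.1 (pow_eq_zero_iff (two_ne_zero) |>.1 h0)
end
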